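/- arXiv:1812.04902 — 3 statements merged into one kernel-verified Lean document; each statement's English description precedes it below -/
import Mathlib

section
/- Let T₀ ∈ (0,∞) and f : (0,T₀] → L²(E;μ) with ∫₀^{T₀} ‖f(t)‖_{L²} dt < ∞. Then u(t) := ∫₀^t ∫₀^∞ P⁰_r f(s) p̄(r, t−s) dr ds is well defined in L²(E;μ) for a.e. t ∈ (0,T₀] with ∫₀^{T₀} ‖u(t)‖_{L²} dt < ∞; for every T ∈ (0,T₀], ∫₀^T w(T−t) ‖u(t)‖_{L²} dt < ∞; and for every φ ∈ 𝒟(𝓛) and every T ∈ (0,T₀], ⟨∫₀^T w(T−s) u(s) ds, φ⟩ = ∫₀^T ⟨f(s), φ⟩ ds + ∫₀^T ⟨u(s), 𝓛φ⟩ ds. -/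
open MeasureTheory Filter Set
open scoped ENNReal Topology RealInnerProductSpace

/-- The (extended nonnegative) two-sided Laplace transform of `f`. -/
noncomputable def laplaceLIntegral (f : ℝ → ℝ≥0∞) (l : ℝ) : ℝ≥0∞ :=
  ∫⁻ x, ENNReal.ofReal (Real.exp (-l * x)) * f x

/-- Convolution of extended nonnegative functions on the line. -/
noncomputable def convLIntegral (a b : ℝ → ℝ≥0∞) (x : ℝ) : ℝ≥0∞ :=
  ∫⁻ y, a (x - y) * b y

/-- Extended nonnegative functions with equal finite Laplace transforms on `(0, ∞)` agree a.e. -/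
theorem ae_eq_of_laplaceLIntegral_eq {f g : ℝ → ℝ≥0∞} (hf : Measurable f) (hg : Measurable g)
    (hfin : ∀ l : ℝ, 0 < l → laplaceLIntegral f l ≠ ⊤)
    (h : ∀ l : ℝ, 0 < l → laplaceLIntegral f l = laplaceLIntegral g l) :
    f =ᵐ[volume] g := by
  set e : ℝ → ℝ≥0∞ := fun x => ENNReal.ofReal (Real.exp (-1 * x)) with he
  have hem : Measurable e := by fun_prop
  have key : ∀ k : ℝ → ℝ≥0∞, Measurable k → ∀ t : ℝ,
      ∫⁻ x, ENNReal.ofReal (Real.exp (t * x)) ∂(volume.withDensity fun x => e x * k x)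
        = laplaceLIntegral k (1 - t) := by
    intro k hk t
    rw [lintegral_withDensity_eq_lintegral_mul _ (by fun_prop : Measurable fun x => e x * k x)
      (by fun_prop), laplaceLIntegral]
    refine lintegral_congr fun x => ?_
    simp only [Pi.mul_apply, he]
    rw [mul_right_comm, ← ENNReal.ofReal_mul (Real.exp_pos _).le, ← Real.exp_add]
    congr 3; ring
  have fin : ∀ k : ℝ → ℝ≥0∞, Measurable k → (∀ l : ℝ, 0 < l → laplaceLIntegral k l ≠ ⊤) →
      IsFiniteMeasure (volume.withDensity fun x => e x * k x) := by
    intro k hk hkf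
    refine isFiniteMeasure_withDensity ?_
    exact hkf 1 one_pos
  have hint : ∀ k : ℝ → ℝ≥0∞, Measurable k → (∀ l : ℝ, 0 < l → laplaceLIntegral k l ≠ ⊤) →
      Iio (1 : ℝ) ⊆ interior (ProbabilityTheory.integrableExpSet id
        (volume.withDensity fun x => e x * k x)) := by
    intro k hk hkf
    refine interior_maximal ?_ isOpen_Iio
    intro t ht
    refine ⟨by fun_prop, ?_⟩
    rw [hasFiniteIntegral_iff_ofReal (ae_of_all _ fun x => (Real.exp_pos _).le)]
    have := key k hk t
    simp only [id] at *
    rw [this]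
    exact (hkf _ (by simpa using ht)).lt_top
  have hgfin : ∀ l : ℝ, 0 < l → laplaceLIntegral g l ≠ ⊤ := fun l hl => h l hl ▸ hfin l hl
  have := fin f hf hfin
  have := fin g hg hgfin
  have han : ∀ k : ℝ → ℝ≥0∞, Measurable k → (∀ l : ℝ, 0 < l → laplaceLIntegral k l ≠ ⊤) →
      AnalyticOnNhd ℂ (ProbabilityTheory.complexMGF id (volume.withDensity fun x => e x * k x))
        {z | z.re < 1} := fun k hk hkf =>
    ProbabilityTheory.analyticOnNhd_complexMGF.mono fun z hz => hint k hk hkf hz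
  have hmgf : ∀ t : ℝ, t < 1 →
      ProbabilityTheory.mgf id (volume.withDensity fun x => e x * f x) t
        = ProbabilityTheory.mgf id (volume.withDensity fun x => e x * g x) t := by
    intro t ht
    have h1 : ∀ k : ℝ → ℝ≥0∞, Measurable k →
        ProbabilityTheory.mgf id (volume.withDensity fun x => e x * k x) t
          = (laplaceLIntegral k (1 - t)).toReal := by
      intro k hk
      rw [ProbabilityTheory.mgf, integral_eq_lintegral_of_nonneg_ae
        (ae_of_all _ fun x => (Real.exp_pos _).le) (by fun_prop)]
      simp only [id]
      rw [key k hk t]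
    rw [h1 f hf, h1 g hg, h _ (by linarith)]
  have heq : Set.EqOn (ProbabilityTheory.complexMGF id (volume.withDensity fun x => e x * f x))
      (ProbabilityTheory.complexMGF id (volume.withDensity fun x => e x * g x))
      {z | z.re < 1} := by
    refine AnalyticOnNhd.eqOn_of_preconnected_of_frequently_eq (han f hf hfin) (han g hg hgfin)
      (convex_halfSpace_re_lt 1).isPreconnected (z₀ := ((0 : ℝ) : ℂ)) (by simp) ?_
    have h_real : ∃ᶠ (x : ℝ) in 𝓝[≠] 0,
        ProbabilityTheory.complexMGF id (volume.withDensity fun x => e x * f x) x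
          = ProbabilityTheory.complexMGF id (volume.withDensity fun x => e x * g x) x := by
      refine Eventually.frequently ?_
      filter_upwards [nhdsWithin_le_nhds (Iio_mem_nhds (zero_lt_one' ℝ))] with x hx
      rw [ProbabilityTheory.complexMGF_ofReal, ProbabilityTheory.complexMGF_ofReal, hmgf x hx]
    rw [frequently_iff_seq_forall] at h_real ⊢
    obtain ⟨xs, hx_tendsto, hx_eq⟩ := h_real
    refine ⟨fun n => xs n, ?_, fun n => ?_⟩
    · rw [tendsto_nhdsWithin_iff] at hx_tendsto ⊢
      constructor
      · have := hx_tendsto.1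
        exact (Complex.continuous_ofReal.tendsto 0).comp this
      · simpa using hx_tendsto.2
    · simpa using hx_eq n
  have hmeas : (volume.withDensity fun x => e x * f x) = volume.withDensity fun x => e x * g x := by
    refine Measure.ext_of_charFun ?_
    ext t
    rw [← ProbabilityTheory.complexMGF_id_mul_I, ← ProbabilityTheory.complexMGF_id_mul_I]
    exact heq (by simp)
  have hae := (withDensity_eq_iff (hem.mul hf).aemeasurable (hem.mul hg).aemeasurable
    (hfin 1 one_pos)).1 hmeas
  filter_upwards [hae] with x hx
  have h0 : e x ≠ 0 := by simp [he, Real.exp_pos]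
  exact (ENNReal.mul_right_inj h0 ENNReal.ofReal_ne_top).1 hx

theorem laplaceLIntegral_conv {a b : ℝ → ℝ≥0∞} (ha : Measurable a) (hb : Measurable b) (l : ℝ) :
    laplaceLIntegral (convLIntegral a b) l = laplaceLIntegral a l * laplaceLIntegral b l := by
  unfold laplaceLIntegral convLIntegral
  calc ∫⁻ x, ENNReal.ofReal (Real.exp (-l * x)) * ∫⁻ y, a (x - y) * b y
      = ∫⁻ x, ∫⁻ y, ENNReal.ofReal (Real.exp (-l * x)) * (a (x - y) * b y) := by
        refine lintegral_congr fun x => ?_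
        rw [lintegral_const_mul _ (by fun_prop)]
    _ = ∫⁻ y, ∫⁻ x, ENNReal.ofReal (Real.exp (-l * x)) * (a (x - y) * b y) :=
        lintegral_lintegral_swap (by fun_prop)
    _ = ∫⁻ y, (∫⁻ x, ENNReal.ofReal (Real.exp (-l * x)) * a x) *
          (ENNReal.ofReal (Real.exp (-l * y)) * b y) := by
        refine lintegral_congr fun y => ?_
        rw [← lintegral_mul_const _ (by fun_prop),
          ← lintegral_sub_right_eq_self (fun x => ENNReal.ofReal (Real.exp (-l * x)) * a x *
          (ENNReal.ofReal (Real.exp (-l * y)) * b y)) y]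
        refine lintegral_congr fun x => ?_
        have : ENNReal.ofReal (Real.exp (-l * x)) = ENNReal.ofReal (Real.exp (-l * (x - y))) *
            ENNReal.ofReal (Real.exp (-l * y)) := by
          rw [← ENNReal.ofReal_mul (Real.exp_pos _).le, ← Real.exp_add]; congr 2; ring
        rw [this]; ring
    _ = _ := by rw [lintegral_const_mul _ (by fun_prop)]

theorem laplaceLIntegral_lintegral {F : ℝ → ℝ → ℝ≥0∞} (hF : Measurable (Function.uncurry F))
    (S : Set ℝ) (l : ℝ) :
    laplaceLIntegral (fun x => ∫⁻ r in S, F r x) l = ∫⁻ r in S, laplaceLIntegral (F r) l := by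
  unfold laplaceLIntegral
  rw [lintegral_lintegral_swap]
  · refine lintegral_congr fun x => ?_
    have hFx : Measurable fun r => F r x := hF.comp (by fun_prop : Measurable fun r : ℝ => (r, x))
    rw [lintegral_const_mul _ hFx]
  · refine Measurable.aemeasurable ?_
    have : Measurable fun p : ℝ × ℝ => F p.1 p.2 := hF
    simp only [Function.uncurry_def]
    fun_prop

theorem lintegral_exp_neg_mul_Ioi {c : ℝ} (hc : 0 < c) (q : ℝ) :
    ∫⁻ r in Ioi q, ENNReal.ofReal (Real.exp (-r * c)) = ENNReal.ofReal (Real.exp (-q * c) / c) := by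
  have h1 : ∀ r : ℝ, -r * c = -c * r := fun r => by ring
  simp_rw [h1]
  rw [← ofReal_integral_eq_lintegral_ofReal (integrableOn_exp_mul_Ioi (by linarith) q)
    (ae_of_all _ fun x => (Real.exp_pos _).le), integral_exp_mul_Ioi (by linarith)]
  congr 1
  rw [neg_div_neg_eq]

theorem laplaceLIntegral_indicator_one {l : ℝ} (hl : 0 < l) :
    laplaceLIntegral ((Ioi 0).indicator 1) l = ENNReal.ofReal (1 / l) := by
  have h := lintegral_exp_neg_mul_Ioi hl 0
  simp only [neg_zero, zero_mul, Real.exp_zero] at h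
  rw [← h, laplaceLIntegral, ← lintegral_indicator measurableSet_Ioi]
  refine lintegral_congr fun x => ?_
  by_cases hx : x ∈ Ioi (0 : ℝ)
  · simp only [indicator_of_mem hx, Pi.one_apply, mul_one]; congr 2; ring
  · simp [indicator_of_notMem hx]

theorem measurable_convLIntegral_param {a : ℝ → ℝ≥0∞} {k : ℝ → ℝ → ℝ≥0∞} (ha : Measurable a)
    (hk : Measurable (Function.uncurry k)) :
    Measurable (Function.uncurry fun r x => convLIntegral a (k r) x) := by
  have : Measurable fun p : ℝ × ℝ => k p.1 p.2 := hk
  have h2 : Measurable fun p : (ℝ × ℝ) × ℝ => a (p.1.2 - p.2) * k p.1.1 p.2 := by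
    refine (ha.comp (by fun_prop)).mul (this.comp (by fun_prop : Measurable
      fun p : (ℝ × ℝ) × ℝ => (p.1.1, p.2)))
  exact h2.lintegral_prod_right'

theorem one_sub_exp_neg_mul_le {l x : ℝ} (hx : 0 < x) :
    1 - Real.exp (-l * x) ≤ max 1 l * min 1 x := by
  have h1 : 1 - Real.exp (-l * x) ≤ 1 := by linarith [Real.exp_pos (-l * x)]
  have h2 : 1 - Real.exp (-l * x) ≤ l * x := by linarith [Real.add_one_le_exp (-l * x)]
  rcases le_total 1 x with h | h
  · rw [min_eq_left h, mul_one]; exact h1.trans (le_max_left _ _)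
  · rw [min_eq_right h]
    exact h2.trans (mul_le_mul_of_nonneg_right (le_max_right _ _) hx.le)

theorem one_sub_exp_neg_mul_pos {l x : ℝ} (hl : 0 < l) (hx : 0 < x) :
    0 < 1 - Real.exp (-l * x) := by
  have : Real.exp (-l * x) < 1 := by rw [Real.exp_lt_one_iff]; nlinarith
  linarith

theorem integrableOn_one_sub_exp {ν : Measure ℝ}
    (hν : ∫⁻ x in Ioi (0:ℝ), ENNReal.ofReal (min 1 x) ∂ν ≠ ⊤) {l : ℝ} (hl : 0 < l) :
    IntegrableOn (fun x => 1 - Real.exp (-l * x)) (Ioi 0) ν := by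
  have h1 : IntegrableOn (fun x : ℝ => min 1 x) (Ioi 0) ν := by
    refine ⟨by fun_prop, ?_⟩
    rw [hasFiniteIntegral_iff_ofReal]
    · exact hν.lt_top
    · filter_upwards [ae_restrict_mem measurableSet_Ioi] with x hx
      exact le_min zero_le_one (le_of_lt hx)
  refine Integrable.mono' (h1.const_mul (max 1 l)) (by fun_prop) ?_
  filter_upwards [ae_restrict_mem measurableSet_Ioi] with x hx
  rw [Real.norm_of_nonneg (one_sub_exp_neg_mul_pos hl hx).le]
  exact one_sub_exp_neg_mul_le hx

theorem ofReal_laplaceExponent {ν : Measure ℝ}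
    (hν : ∫⁻ x in Ioi (0:ℝ), ENNReal.ofReal (min 1 x) ∂ν ≠ ⊤) {l : ℝ} (hl : 0 < l) :
    ENNReal.ofReal (∫ x in Ioi (0:ℝ), (1 - Real.exp (-l * x)) ∂ν)
      = ∫⁻ x in Ioi (0:ℝ), ENNReal.ofReal (1 - Real.exp (-l * x)) ∂ν := by
  refine ofReal_integral_eq_lintegral_ofReal (integrableOn_one_sub_exp hν hl) ?_
  filter_upwards [ae_restrict_mem measurableSet_Ioi] with x hx
  exact (one_sub_exp_neg_mul_pos hl hx).le

theorem laplaceExponent_pos {ν : Measure ℝ}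
    (hν : ∫⁻ x in Ioi (0:ℝ), ENNReal.ofReal (min 1 x) ∂ν ≠ ⊤)
    (hν' : ν (Ioi (0:ℝ)) ≠ 0) {l : ℝ} (hl : 0 < l) :
    0 < ∫ x in Ioi (0:ℝ), (1 - Real.exp (-l * x)) ∂ν := by
  rw [setIntegral_pos_iff_support_of_nonneg_ae ?_ (integrableOn_one_sub_exp hν hl)]
  · refine (pos_iff_ne_zero.2 hν').trans_le (measure_mono fun x hx => ⟨?_, hx⟩)
    exact (one_sub_exp_neg_mul_pos hl hx).ne'
  · filter_upwards [ae_restrict_mem measurableSet_Ioi] with x hx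
    exact (one_sub_exp_neg_mul_pos hl hx).le

theorem sFinite_restrict_of_lintegral_min {ν : Measure ℝ}
    (hν : ∫⁻ x in Ioi (0:ℝ), ENNReal.ofReal (min 1 x) ∂ν ≠ ⊤) :
    SFinite (ν.restrict (Ioi 0)) := by
  have := isFiniteMeasure_withDensity hν
  rw [← withDensity_inv_same (μ := ν.restrict (Ioi 0))
    (f := fun x : ℝ => ENNReal.ofReal (min 1 x)) (by fun_prop) ?_ ?_]
  · infer_instance
  · filter_upwards [ae_restrict_mem measurableSet_Ioi] with x hx
    simpa using hx
  · simp

theorem measure_Ioi_ne_top {ν : Measure ℝ}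
    (hν : ∫⁻ x in Ioi (0:ℝ), ENNReal.ofReal (min 1 x) ∂ν ≠ ⊤) {x : ℝ} (hx : 0 < x) :
    ν (Ioi x) ≠ ⊤ := by
  have hm : 0 < min 1 x := lt_min one_pos hx
  intro htop
  refine hν (top_le_iff.1 ?_)
  calc (⊤ : ℝ≥0∞) = ENNReal.ofReal (min 1 x) * ν (Ioi x) := by
        rw [htop, ENNReal.mul_top]; simpa using hm
    _ = ∫⁻ y in Ioi x, ENNReal.ofReal (min 1 x) ∂ν := by rw [setLIntegral_const]
    _ ≤ ∫⁻ y in Ioi x, ENNReal.ofReal (min 1 y) ∂ν := by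
        refine setLIntegral_mono (by fun_prop) fun y hy => ?_
        exact ENNReal.ofReal_le_ofReal (min_le_min_left _ (le_of_lt hy))
    _ ≤ _ := lintegral_mono_set (Ioi_subset_Ioi hx.le)

theorem measurable_measure_Ioi (ν : Measure ℝ) : Measurable fun x => ν (Ioi x) :=
  Antitone.measurable fun _ _ h => measure_mono (Ioi_subset_Ioi h)

theorem lintegral_exp_neg_mul_Ioo {l y : ℝ} (hl : 0 < l) (hy : 0 < y) :
    ∫⁻ x in Ioo 0 y, ENNReal.ofReal (Real.exp (-l * x))
      = ENNReal.ofReal (1 / l) * ENNReal.ofReal (1 - Real.exp (-l * y)) := by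
  rw [← ENNReal.ofReal_mul (by positivity), ← ofReal_integral_eq_lintegral_ofReal
    ((by fun_prop : Continuous fun x : ℝ => Real.exp (-l * x)).integrableOn_Icc.mono_set
      Ioo_subset_Icc_self) (ae_of_all _ fun x => (Real.exp_pos _).le),
    ← integral_Ioc_eq_integral_Ioo, ← intervalIntegral.integral_of_le hy.le]
  congr 1
  rw [intervalIntegral.integral_comp_mul_left (fun x => Real.exp x) (neg_ne_zero.2 hl.ne'),
    integral_exp]
  simp only [mul_zero, Real.exp_zero, smul_eq_mul]
  field_simp
  ring

theorem laplaceLIntegral_tail {ν : Measure ℝ}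
    (hν : ∫⁻ x in Ioi (0:ℝ), ENNReal.ofReal (min 1 x) ∂ν ≠ ⊤) {l : ℝ} (hl : 0 < l) :
    laplaceLIntegral ((Ioi 0).indicator fun x => ν (Ioi x)) l
      = ENNReal.ofReal (1 / l) *
        ENNReal.ofReal (∫ x in Ioi (0:ℝ), (1 - Real.exp (-l * x)) ∂ν) := by
  have := sFinite_restrict_of_lintegral_min hν
  rw [ofReal_laplaceExponent hν hl, laplaceLIntegral]
  have hmeas : MeasurableSet {p : ℝ × ℝ | 0 < p.1 ∧ p.1 < p.2} :=
    (measurableSet_lt measurable_const measurable_fst).inter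
      (measurableSet_lt measurable_fst measurable_snd)
  calc _ = ∫⁻ x, ∫⁻ y in Ioi 0, {p : ℝ × ℝ | 0 < p.1 ∧ p.1 < p.2}.indicator
          (fun p => ENNReal.ofReal (Real.exp (-l * p.1))) (x, y) ∂ν := by
        refine lintegral_congr fun x => ?_
        by_cases hx : 0 < x
        · have h1 : ∀ y, {p : ℝ × ℝ | 0 < p.1 ∧ p.1 < p.2}.indicator
              (fun p => ENNReal.ofReal (Real.exp (-l * p.1))) (x, y)
              = (Ioi x).indicator (fun _ => ENNReal.ofReal (Real.exp (-l * x))) y := by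
            intro y
            simp [indicator_apply, hx]
          simp_rw [h1]
          rw [lintegral_indicator measurableSet_Ioi, setLIntegral_const,
            Measure.restrict_apply measurableSet_Ioi,
            inter_eq_left.2 (Ioi_subset_Ioi hx.le), indicator_of_mem (by exact hx)]
        · simp [hx]
    _ = ∫⁻ y in Ioi 0, (∫⁻ x, {p : ℝ × ℝ | 0 < p.1 ∧ p.1 < p.2}.indicator
          (fun p => ENNReal.ofReal (Real.exp (-l * p.1))) (x, y)) ∂ν := by
        refine lintegral_lintegral_swap (Measurable.aemeasurable ?_)
        exact Measurable.indicator (by fun_prop) hmeas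
    _ = ∫⁻ y in Ioi 0, ENNReal.ofReal (1 / l) * ENNReal.ofReal (1 - Real.exp (-l * y)) ∂ν := by
        refine setLIntegral_congr_fun measurableSet_Ioi fun y hy => ?_
        rw [← lintegral_exp_neg_mul_Ioo hl hy, ← lintegral_indicator measurableSet_Ioo]
        refine lintegral_congr fun x => ?_
        simp [indicator_apply]
    _ = _ := by rw [lintegral_const_mul _ (by fun_prop)]

theorem laplaceLIntegral_density {m : Measure ℝ} {p : ℝ → ℝ} (hp : Measurable p)
    (hdens : ∀ A : Set ℝ, MeasurableSet A → m A = ∫⁻ t in A ∩ Ici 0, ENNReal.ofReal (p t))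
    {l c : ℝ} (hlap : ∫ s, Real.exp (-l * s) ∂m = Real.exp c) :
    laplaceLIntegral (fun y => ENNReal.ofReal ((Ioi 0).indicator p y)) l
      = ENNReal.ofReal (Real.exp c) := by
  have hm : m = (volume.restrict (Ici 0)).withDensity fun t => ENNReal.ofReal (p t) := by
    ext A hA
    rw [hdens A hA, withDensity_apply _ hA, Measure.restrict_restrict hA]
  have hint : Integrable (fun s => Real.exp (-l * s)) m := by
    by_contra hcon
    rw [integral_undef hcon] at hlap
    exact (Real.exp_pos c).ne hlap
  rw [← hlap, ofReal_integral_eq_lintegral_ofReal hint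
    (ae_of_all _ fun x => (Real.exp_pos _).le), hm,
    lintegral_withDensity_eq_lintegral_mul _ (by fun_prop) (by fun_prop),
    setLIntegral_congr Ioi_ae_eq_Ici.symm, ← lintegral_indicator measurableSet_Ioi,
    laplaceLIntegral]
  refine lintegral_congr fun x => ?_
  by_cases hx : 0 < x <;> simp [hx, mul_comm]

/-- The potential density is locally integrable. -/
theorem lintegral_potential_ne_top {k : ℝ → ℝ → ℝ≥0∞} (hk : Measurable (Function.uncurry k))
    {Φ : ℝ → ℝ} (hΦ : ∀ l : ℝ, 0 < l → 0 < Φ l)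
    (hlap : ∀ r : ℝ, 0 < r → ∀ l : ℝ, 0 < l →
      laplaceLIntegral (k r) l = ENNReal.ofReal (Real.exp (-r * Φ l))) (X : ℝ) :
    ∫⁻ y in Iic X, ∫⁻ r in Ioi (0:ℝ), k r y ≠ ⊤ := by
  have h1 : laplaceLIntegral (fun y => ∫⁻ r in Ioi (0:ℝ), k r y) 1 ≠ ⊤ := by
    rw [laplaceLIntegral_lintegral hk, setLIntegral_congr_fun measurableSet_Ioi
      (fun r hr => hlap r hr 1 one_pos), lintegral_exp_neg_mul_Ioi (hΦ 1 one_pos)]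
    exact ENNReal.ofReal_ne_top
  have hG : Measurable fun y => ∫⁻ r in Ioi (0:ℝ), k r y :=
    (hk.comp measurable_swap).lintegral_prod_right'
  refine ne_top_of_le_ne_top (ENNReal.mul_ne_top (ENNReal.ofReal_ne_top (r := Real.exp X)) h1) ?_
  rw [laplaceLIntegral, ← lintegral_const_mul _ (by fun_prop)]
  refine (setLIntegral_mono (g := fun y => ENNReal.ofReal (Real.exp X) *
    (ENNReal.ofReal (Real.exp (-1 * y)) * ∫⁻ r in Ioi (0:ℝ), k r y)) (by fun_prop)
    fun y hy => ?_).trans (setLIntegral_le_lintegral _ _)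
  rw [← mul_assoc, ← ENNReal.ofReal_mul (Real.exp_pos _).le, ← Real.exp_add]
  refine le_mul_of_one_le_left zero_le ?_
  rw [ENNReal.one_le_ofReal, Real.one_le_exp_iff]
  have : y ≤ X := hy
  linarith

section Sonine

variable {k : ℝ → ℝ → ℝ≥0∞} {W : ℝ → ℝ≥0∞} {Φ : ℝ → ℝ}

theorem laplaceLIntegral_lintegral_Ioi_conv (hk : Measurable (Function.uncurry k))
    (hW : Measurable W) (hΦ : ∀ l : ℝ, 0 < l → 0 < Φ l)
    (hWlap : ∀ l : ℝ, 0 < l →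
      laplaceLIntegral W l = ENNReal.ofReal (1 / l) * ENNReal.ofReal (Φ l))
    (hlap : ∀ r : ℝ, 0 < r → ∀ l : ℝ, 0 < l →
      laplaceLIntegral (k r) l = ENNReal.ofReal (Real.exp (-r * Φ l)))
    {q : ℝ} (hq : 0 ≤ q) {l : ℝ} (hl : 0 < l) :
    laplaceLIntegral (fun x => ∫⁻ r in Ioi q, convLIntegral W (k r) x) l
      = ENNReal.ofReal (1 / l) * ENNReal.ofReal (Real.exp (-q * Φ l)) := by
  have hkr : ∀ r, Measurable (k r) := fun r => hk.comp (by fun_prop : Measurable fun x => (r, x))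
  rw [laplaceLIntegral_lintegral (measurable_convLIntegral_param hW hk),
    setLIntegral_congr_fun measurableSet_Ioi (g := fun r => ENNReal.ofReal (1 / l) *
      ENNReal.ofReal (Φ l) * ENNReal.ofReal (Real.exp (-r * Φ l))) fun r hr => ?_,
    lintegral_const_mul _ (by fun_prop), lintegral_exp_neg_mul_Ioi (hΦ l hl), mul_assoc,
    ← ENNReal.ofReal_mul (hΦ l hl).le]
  · have := (hΦ l hl).ne'
    congr 2
    field_simp
  · simp only
    rw [laplaceLIntegral_conv hW (hkr r), hWlap l hl, hlap r (hq.trans_lt hr) l hl]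

theorem lintegral_Ioi_zero_conv_ae_eq (hk : Measurable (Function.uncurry k))
    (hW : Measurable W) (hΦ : ∀ l : ℝ, 0 < l → 0 < Φ l)
    (hWlap : ∀ l : ℝ, 0 < l →
      laplaceLIntegral W l = ENNReal.ofReal (1 / l) * ENNReal.ofReal (Φ l))
    (hlap : ∀ r : ℝ, 0 < r → ∀ l : ℝ, 0 < l →
      laplaceLIntegral (k r) l = ENNReal.ofReal (Real.exp (-r * Φ l))) :
    (fun x => ∫⁻ r in Ioi (0:ℝ), convLIntegral W (k r) x) =ᵐ[volume] (Ioi 0).indicator 1 := by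
  have h := fun (l : ℝ) (hl : 0 < l) =>
    laplaceLIntegral_lintegral_Ioi_conv hk hW hΦ hWlap hlap le_rfl hl
  simp only [neg_zero, zero_mul, Real.exp_zero, ENNReal.ofReal_one, mul_one] at h
  refine ae_eq_of_laplaceLIntegral_eq
    ((measurable_convLIntegral_param hW hk).comp measurable_swap).lintegral_prod_right'
    (measurable_one.indicator measurableSet_Ioi) (fun l hl => ?_) fun l hl => ?_
  · rw [h l hl]; exact ENNReal.ofReal_ne_top
  · rw [h l hl, laplaceLIntegral_indicator_one hl]

theorem lintegral_Ioi_conv_ae_eq (hk : Measurable (Function.uncurry k))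
    (hW : Measurable W) (hΦ : ∀ l : ℝ, 0 < l → 0 < Φ l)
    (hWlap : ∀ l : ℝ, 0 < l →
      laplaceLIntegral W l = ENNReal.ofReal (1 / l) * ENNReal.ofReal (Φ l))
    (hlap : ∀ r : ℝ, 0 < r → ∀ l : ℝ, 0 < l →
      laplaceLIntegral (k r) l = ENNReal.ofReal (Real.exp (-r * Φ l))) {q : ℝ} (hq : 0 < q) :
    (fun x => ∫⁻ r in Ioi q, convLIntegral W (k r) x)
      =ᵐ[volume] convLIntegral ((Ioi 0).indicator 1) (k q) := by
  have hkr : ∀ r, Measurable (k r) := fun r => hk.comp (by fun_prop : Measurable fun x => (r, x))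
  have h := fun (l : ℝ) (hl : 0 < l) =>
    laplaceLIntegral_lintegral_Ioi_conv hk hW hΦ hWlap hlap hq.le hl
  have h1 : Measurable ((Ioi (0:ℝ)).indicator (1 : ℝ → ℝ≥0∞)) :=
    measurable_one.indicator measurableSet_Ioi
  refine ae_eq_of_laplaceLIntegral_eq
    ((measurable_convLIntegral_param hW hk).comp measurable_swap).lintegral_prod_right'
    ((measurable_convLIntegral_param h1 hk).comp (by fun_prop : Measurable fun x => (q, x)))
    (fun l hl => ?_) fun l hl => ?_
  · rw [h l hl]; exact ENNReal.mul_ne_top ENNReal.ofReal_ne_top ENNReal.ofReal_ne_top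
  · rw [h l hl, laplaceLIntegral_conv h1 (hkr q), laplaceLIntegral_indicator_one hl,
      hlap q hq l hl]

end Sonine

/-- Fubini for a mixture of primitives: `∫ j(r) ∫₀^r b = ∫ b(q) j((q,∞))`. -/
theorem integral_mul_primitive_eq {j F : ℝ → ℝ≥0∞} (hj : Measurable j)
    (hj_fin : ∫⁻ r in Ioi (0:ℝ), j r ≠ ⊤)
    (hF : ∀ᵐ q ∂(volume.restrict (Ioi (0:ℝ))), ∫⁻ r in Ioi q, j r = F q)
    (hF_fin : ∫⁻ q in Ioi (0:ℝ), F q ≠ ⊤)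
    {a b : ℝ → ℝ} {B : ℝ} (hb : Continuous b) (hbB : ∀ q, |b q| ≤ B)
    (hab : ∀ r : ℝ, 0 ≤ r → a r = a 0 + ∫ q in (0:ℝ)..r, b q) :
    ∫ r in Ioi (0:ℝ), (j r).toReal * a r
      = (∫⁻ r in Ioi (0:ℝ), j r).toReal * a 0 + ∫ q in Ioi (0:ℝ), (F q).toReal * b q := by
  set m : Measure ℝ := volume.restrict (Ioi (0:ℝ)) with hm
  have hjtop : ∀ᵐ r ∂m, j r < ⊤ := ae_lt_top hj hj_fin
  have hset : MeasurableSet {p : ℝ × ℝ | p.2 < p.1} := measurableSet_lt measurable_snd measurable_fst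
  set G : ℝ × ℝ → ℝ := {p : ℝ × ℝ | p.2 < p.1}.indicator fun p => (j p.1).toReal * b p.2 with hG
  have hGm : Measurable G := by
    refine Measurable.indicator ?_ hset
    exact (hj.comp measurable_fst).ennreal_toReal.mul (hb.measurable.comp measurable_snd)
  have hind : ∀ q, 0 < q → ∀ c : ℝ → ℝ≥0∞,
      ∫⁻ r in Ioi 0, (Ioi q).indicator c r = ∫⁻ r in Ioi q, c r := by
    intro q hq c
    rw [lintegral_indicator measurableSet_Ioi, Measure.restrict_restrict measurableSet_Ioi,
      inter_eq_left.2 (Ioi_subset_Ioi hq.le)]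
  have hGi : Integrable G (m.prod m) := by
    refine ⟨hGm.aestronglyMeasurable, ?_⟩
    rw [HasFiniteIntegral, lintegral_prod_symm _ (by fun_prop)]
    refine lt_of_le_of_lt ?_ (ENNReal.mul_lt_top (ENNReal.ofReal_lt_top (r := B)) hF_fin.lt_top)
    rw [← lintegral_const_mul' _ _ ENNReal.ofReal_ne_top]
    refine lintegral_mono_ae ?_
    filter_upwards [hF, ae_restrict_mem measurableSet_Ioi] with q hq hq0
    rw [← hq, ← lintegral_const_mul _ hj, ← hind q hq0]
    refine lintegral_mono fun r => ?_
    by_cases hqr : q < r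
    · rw [indicator_of_mem (by exact hqr), hG, indicator_of_mem (by exact hqr), enorm_mul, mul_comm]
      refine mul_le_mul' ?_ ?_
      · rw [Real.enorm_eq_ofReal_abs]; exact ENNReal.ofReal_le_ofReal (hbB q)
      · rw [Real.enorm_eq_ofReal ENNReal.toReal_nonneg]; exact ENNReal.ofReal_toReal_le
    · simp [hG, hqr]
  have hinner1 : ∀ r, 0 < r → ∫ q, G (r, q) ∂m = (j r).toReal * ∫ q in (0:ℝ)..r, b q := by
    intro r hr
    have : ∀ q, G (r, q) = (Iio r).indicator (fun q => (j r).toReal * b q) q := fun q => rfl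
    simp_rw [this]
    rw [integral_indicator measurableSet_Iio, hm, Measure.restrict_restrict measurableSet_Iio,
      inter_comm, Ioi_inter_Iio, integral_const_mul, ← integral_Ioc_eq_integral_Ioo,
      intervalIntegral.integral_of_le hr.le]
  have hinner2 : ∀ᵐ q ∂m, ∫ r, G (r, q) ∂m = (F q).toReal * b q := by
    filter_upwards [hF, ae_restrict_mem measurableSet_Ioi] with q hq hq0
    have : ∀ r, G (r, q) = (Ioi q).indicator (fun r => (j r).toReal * b q) r := fun r => rfl
    simp_rw [this]
    have hsub : Ioi q ⊆ Ioi (0:ℝ) := Ioi_subset_Ioi (le_of_lt hq0)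
    rw [integral_indicator measurableSet_Ioi, hm, Measure.restrict_restrict measurableSet_Ioi,
      inter_eq_left.2 hsub, integral_mul_const, integral_toReal hj.aemeasurable
        (ae_mono (Measure.restrict_mono hsub le_rfl) hjtop), hq]
  have hji : Integrable (fun r => (j r).toReal) m := integrable_toReal_of_lintegral_ne_top
    hj.aemeasurable hj_fin
  calc ∫ r, (j r).toReal * a r ∂m
      = ∫ r, ((j r).toReal * a 0 + ∫ q, G (r, q) ∂m) ∂m := by
        refine integral_congr_ae ?_
        filter_upwards [ae_restrict_mem measurableSet_Ioi] with r hr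
        rw [hinner1 r hr, hab r (le_of_lt hr), mul_add]
    _ = (∫ r, (j r).toReal * a 0 ∂m) + ∫ r, ∫ q, G (r, q) ∂m ∂m :=
        integral_add (hji.mul_const _) hGi.integral_prod_left
    _ = _ := by
        rw [integral_mul_const, integral_toReal hj.aemeasurable hjtop,
          integral_integral_swap (f := fun r q => G (r, q)) hGi, integral_congr_ae hinner2]

section Duality

variable {E : Type*} [NormedAddCommGroup E] {f : ℝ → E} {k : ℝ → ℝ → ℝ}

/-- The pointwise majorant of the norm of the subordinated Duhamel integral. -/
noncomputable def duhamelMajorant (k : ℝ → ℝ → ℝ) (f : ℝ → E) (t : ℝ) : ℝ≥0∞ :=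
  ∫⁻ s, ∫⁻ r in Ioi (0:ℝ), ENNReal.ofReal (k r (t - s)) * ‖f s‖ₑ

theorem measurable_kernel_ofReal (hf : StronglyMeasurable f) (hk : Measurable (Function.uncurry k)) :
    Measurable fun p : ℝ × ℝ × ℝ => ENNReal.ofReal (k p.2.2 (p.1 - p.2.1)) * ‖f p.2.1‖ₑ := by
  have h1 : Measurable fun p : ℝ × ℝ × ℝ => k p.2.2 (p.1 - p.2.1) :=
    hk.comp (by fun_prop : Measurable fun p : ℝ × ℝ × ℝ => (p.2.2, p.1 - p.2.1))
  exact h1.ennreal_ofReal.mul (hf.enorm.comp (measurable_fst.comp measurable_snd))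

theorem duhamelMajorant_eq_prod (hf : StronglyMeasurable f) (hk : Measurable (Function.uncurry k))
    (t : ℝ) : duhamelMajorant k f t = ∫⁻ p, ENNReal.ofReal (k p.2 (t - p.1)) * ‖f p.1‖ₑ
      ∂(volume.prod (volume.restrict (Ioi (0:ℝ)))) := by
  have hm : Measurable fun p : ℝ × ℝ => ENNReal.ofReal (k p.2 (t - p.1)) * ‖f p.1‖ₑ :=
    (measurable_kernel_ofReal hf hk).comp measurable_prodMk_left
  rw [lintegral_prod _ hm.aemeasurable]
  rfl

theorem lintegral_mul_duhamelMajorant {V : ℝ → ℝ≥0∞} (hV : Measurable V)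
    (hf : StronglyMeasurable f) (hk : Measurable (Function.uncurry k)) (T : ℝ) :
    ∫⁻ t, V (T - t) * duhamelMajorant k f t
      = ∫⁻ s, ‖f s‖ₑ * ∫⁻ r in Ioi (0:ℝ),
          convLIntegral V (fun y => ENNReal.ofReal (k r y)) (T - s) := by
  have hm := measurable_kernel_ofReal hf hk
  have hm2 : Measurable fun p : ℝ × ℝ × ℝ =>
      V (T - p.1) * (ENNReal.ofReal (k p.2.2 (p.1 - p.2.1)) * ‖f p.2.1‖ₑ) :=
    (hV.comp (by fun_prop : Measurable fun p : ℝ × ℝ × ℝ => T - p.1)).mul hm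
  calc ∫⁻ t, V (T - t) * duhamelMajorant k f t
      = ∫⁻ t, ∫⁻ p, V (T - t) * (ENNReal.ofReal (k p.2 (t - p.1)) * ‖f p.1‖ₑ)
          ∂(volume.prod (volume.restrict (Ioi (0:ℝ)))) := by
        refine lintegral_congr fun t => ?_
        rw [duhamelMajorant_eq_prod hf hk, lintegral_const_mul]
        exact hm.comp measurable_prodMk_left
    _ = ∫⁻ p, (∫⁻ t, V (T - t) * (ENNReal.ofReal (k p.2 (t - p.1)) * ‖f p.1‖ₑ))
          ∂(volume.prod (volume.restrict (Ioi (0:ℝ)))) :=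
        lintegral_lintegral_swap hm2.aemeasurable
    _ = ∫⁻ p, ‖f p.1‖ₑ * convLIntegral V (fun y => ENNReal.ofReal (k p.2 y)) (T - p.1)
          ∂(volume.prod (volume.restrict (Ioi (0:ℝ)))) := by
        refine lintegral_congr fun p => ?_
        have hkp : Measurable fun y => k p.2 y := hk.comp measurable_prodMk_left
        rw [convLIntegral, ← lintegral_const_mul _ (by fun_prop), ← lintegral_sub_right_eq_self
          (fun y => ‖f p.1‖ₑ * (V (T - p.1 - y) * ENNReal.ofReal (k p.2 y))) p.1]
        refine lintegral_congr fun t => ?_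
        rw [show T - p.1 - (t - p.1) = T - t by ring]
        ring
    _ = _ := by
        have hc := measurable_convLIntegral_param (k := fun r y => ENNReal.ofReal (k r y)) hV
          (by exact hk.ennreal_ofReal)
        have hc2 : Measurable fun p : ℝ × ℝ =>
            convLIntegral V (fun y => ENNReal.ofReal (k p.2 y)) (T - p.1) :=
          hc.comp (by fun_prop : Measurable fun p : ℝ × ℝ => (p.2, T - p.1))
        have hm3 : Measurable fun p : ℝ × ℝ => ‖f p.1‖ₑ *
            convLIntegral V (fun y => ENNReal.ofReal (k p.2 y)) (T - p.1) :=
          (hf.enorm.comp measurable_fst).mul hc2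
        rw [lintegral_prod _ hm3.aemeasurable]
        refine lintegral_congr fun s => ?_
        have hc3 : Measurable fun r =>
            convLIntegral V (fun y => ENNReal.ofReal (k r y)) (T - s) :=
          hc2.comp measurable_prodMk_left
        exact lintegral_const_mul ‖f s‖ₑ hc3

theorem integral_kernel_inner {V : ℝ → ℝ} (hV : Measurable V) (hV0 : ∀ x, 0 ≤ V x)
    (hk : Measurable (Function.uncurry k)) (hk0 : ∀ r y, 0 ≤ k r y) (T s r : ℝ) :
    ∫ t, V (T - t) * k r (t - s) = (convLIntegral (fun x => ENNReal.ofReal (V x))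
      (fun y => ENNReal.ofReal (k r y)) (T - s)).toReal := by
  have hkr : Measurable fun y => k r y := hk.comp measurable_prodMk_left
  rw [integral_eq_lintegral_of_nonneg_ae (ae_of_all _ fun t => mul_nonneg (hV0 _) (hk0 _ _))
    (by fun_prop), convLIntegral, ← lintegral_sub_right_eq_self (fun y =>
      ENNReal.ofReal (V (T - s - y)) * ENNReal.ofReal (k r y)) s]
  congr 1
  refine lintegral_congr fun t => ?_
  rw [ENNReal.ofReal_mul (hV0 _), show T - s - (t - s) = T - t by ring]

variable [InnerProductSpace ℝ E] {Q : ℝ → E →L[ℝ] E}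

theorem continuous_uncurry_of_norm_le_one (hQ : ∀ r, ‖Q r‖ ≤ 1)
    (hQc : ∀ g, Continuous fun r => Q r g) : Continuous fun p : ℝ × E => Q p.1 p.2 := by
  refine continuous_prod_of_continuous_lipschitzWith' (fun p : ℝ × E => Q p.1 p.2) 1
    (fun r => ?_) fun g => hQc g
  exact (Q r).lipschitz.weaken (by exact_mod_cast hQ r)

theorem stronglyMeasurable_kernel_smul (hQ : ∀ r, ‖Q r‖ ≤ 1)
    (hQc : ∀ g, Continuous fun r => Q r g) (hf : StronglyMeasurable f)
    (hk : Measurable (Function.uncurry k)) :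
    StronglyMeasurable fun p : ℝ × ℝ × ℝ => k p.2.2 (p.1 - p.2.1) • Q p.2.2 (f p.2.1) := by
  have h1 : Measurable fun p : ℝ × ℝ × ℝ => k p.2.2 (p.1 - p.2.1) :=
    hk.comp (by fun_prop : Measurable fun p : ℝ × ℝ × ℝ => (p.2.2, p.1 - p.2.1))
  refine h1.stronglyMeasurable.smul ?_
  refine (continuous_uncurry_of_norm_le_one hQ hQc).comp_stronglyMeasurable
    (g := fun p : ℝ × E => Q p.1 p.2) (f := fun p : ℝ × ℝ × ℝ => (p.2.2, f p.2.1)) ?_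
  exact (measurable_snd.comp measurable_snd).stronglyMeasurable.prodMk
    (hf.comp_measurable (measurable_fst.comp measurable_snd))

theorem enorm_kernel_smul_le (hQ : ∀ r, ‖Q r‖ ≤ 1) (hk0 : ∀ r y, 0 ≤ k r y) (g : E) (r y : ℝ) :
    ‖k r y • Q r g‖ₑ ≤ ENNReal.ofReal (k r y) * ‖g‖ₑ := by
  rw [enorm_smul, Real.enorm_eq_ofReal (hk0 r y)]
  gcongr
  rw [enorm_le_iff_norm_le]
  exact (Q r).le_of_opNorm_le (hQ r) g |>.trans_eq (one_mul _)

/-- The subordinated Duhamel integral of `f` over the whole line. -/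
noncomputable def duhamel (Q : ℝ → E →L[ℝ] E) (k : ℝ → ℝ → ℝ) (f : ℝ → E) (t : ℝ) : E :=
  ∫ s, ∫ r in Ioi (0:ℝ), k r (t - s) • Q r (f s)

theorem enorm_duhamel_le (hQ : ∀ r, ‖Q r‖ ≤ 1) (hk0 : ∀ r y, 0 ≤ k r y) (t : ℝ) :
    ‖duhamel Q k f t‖ₑ ≤ duhamelMajorant k f t := by
  refine (enorm_integral_le_lintegral_enorm _).trans (lintegral_mono fun s => ?_)
  refine (enorm_integral_le_lintegral_enorm _).trans (lintegral_mono fun r => ?_)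
  exact enorm_kernel_smul_le hQ hk0 _ _ _

theorem integrable_kernel_smul (hQ : ∀ r, ‖Q r‖ ≤ 1)
    (hQc : ∀ g, Continuous fun r => Q r g) (hf : StronglyMeasurable f)
    (hk : Measurable (Function.uncurry k)) (hk0 : ∀ r y, 0 ≤ k r y) {t : ℝ}
    (ht : duhamelMajorant k f t ≠ ⊤) :
    Integrable (fun p : ℝ × ℝ => k p.2 (t - p.1) • Q p.2 (f p.1))
      (volume.prod (volume.restrict (Ioi (0:ℝ)))) := by
  refine ⟨((stronglyMeasurable_kernel_smul hQ hQc hf hk).comp_measurable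
    measurable_prodMk_left).aestronglyMeasurable, ?_⟩
  refine lt_of_le_of_lt (lintegral_mono fun p => enorm_kernel_smul_le hQ hk0 _ _ _) ?_
  rw [← duhamelMajorant_eq_prod hf hk]
  exact ht.lt_top

theorem stronglyMeasurable_duhamel (hQ : ∀ r, ‖Q r‖ ≤ 1)
    (hQc : ∀ g, Continuous fun r => Q r g) (hf : StronglyMeasurable f)
    (hk : Measurable (Function.uncurry k)) : StronglyMeasurable (duhamel Q k f) := by
  have h := (stronglyMeasurable_kernel_smul hQ hQc hf hk).comp_measurable
    (by fun_prop : Measurable fun q : (ℝ × ℝ) × ℝ => (q.1.1, q.1.2, q.2))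
  exact (h.integral_prod_right' (ν := volume.restrict (Ioi (0:ℝ)))).integral_prod_right'

/-- Weighted time integrals of the Duhamel integral, tested against `ψ`. -/
theorem inner_integral_duhamel [CompleteSpace E] {V : ℝ → ℝ} (hQ : ∀ r, ‖Q r‖ ≤ 1)
    (hQc : ∀ g, Continuous fun r => Q r g) (hQs : ∀ r, ∀ g h, ⟪Q r g, h⟫ = ⟪g, Q r h⟫)
    (hf : StronglyMeasurable f) (hk : Measurable (Function.uncurry k)) (hk0 : ∀ r y, 0 ≤ k r y)
    (hV : Measurable V) (hV0 : ∀ x, 0 ≤ V x) {T : ℝ}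
    (hfin : ∫⁻ s, ‖f s‖ₑ * ∫⁻ r in Ioi (0:ℝ), convLIntegral (fun x => ENNReal.ofReal (V x))
      (fun y => ENNReal.ofReal (k r y)) (T - s) ≠ ⊤) (ψ : E) :
    Integrable (fun s => ∫ r in Ioi (0:ℝ), (convLIntegral (fun x => ENNReal.ofReal (V x))
      (fun y => ENNReal.ofReal (k r y)) (T - s)).toReal * ⟪f s, Q r ψ⟫) ∧
    ⟪∫ t, V (T - t) • duhamel Q k f t, ψ⟫ = ∫ s, ∫ r in Ioi (0:ℝ),
      (convLIntegral (fun x => ENNReal.ofReal (V x))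
        (fun y => ENNReal.ofReal (k r y)) (T - s)).toReal * ⟪f s, Q r ψ⟫ := by
  set m : Measure (ℝ × ℝ) := volume.prod (volume.restrict (Ioi (0:ℝ))) with hm
  set F : ℝ × ℝ × ℝ → E := fun p => V (T - p.1) • k p.2.2 (p.1 - p.2.1) • Q p.2.2 (f p.2.1)
    with hFdef
  have hVT : Measurable fun t => V (T - t) := by fun_prop
  have hFm : StronglyMeasurable F := (hVT.comp measurable_fst).stronglyMeasurable.smul
    (stronglyMeasurable_kernel_smul hQ hQc hf hk)
  have hFi : Integrable F (volume.prod m) := by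
    refine ⟨hFm.aestronglyMeasurable, ?_⟩
    rw [HasFiniteIntegral, lintegral_prod _ hFm.enorm.aemeasurable]
    refine lt_of_le_of_lt ?_ hfin.lt_top
    rw [← lintegral_mul_duhamelMajorant hV.ennreal_ofReal hf hk T]
    refine lintegral_mono fun t => ?_
    rw [duhamelMajorant_eq_prod hf hk, ← lintegral_const_mul' _ _ ENNReal.ofReal_ne_top]
    refine lintegral_mono fun p => ?_
    rw [hFdef, enorm_smul, Real.enorm_eq_ofReal (hV0 _)]
    exact mul_le_mul_right (enorm_kernel_smul_le hQ hk0 _ _ _) _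
  have hu : (fun t => V (T - t) • duhamel Q k f t) =ᵐ[volume] fun t => ∫ p, F (t, p) ∂m := by
    filter_upwards [hFi.prod_right_ae] with t ht
    rw [hm, integral_prod _ ht, duhamel, ← integral_smul]
    congr 1 with s
    rw [← integral_smul]
  have hG : Integrable (fun p => ⟪F p, ψ⟫) (volume.prod m) := hFi.inner_const ψ
  have hslice : ∀ p : ℝ × ℝ, ∫ t, ⟪F (t, p), ψ⟫ = (convLIntegral (fun x => ENNReal.ofReal (V x))
      (fun y => ENNReal.ofReal (k p.2 y)) (T - p.1)).toReal * ⟪f p.1, Q p.2 ψ⟫ := by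
    intro p
    rw [← integral_kernel_inner hV hV0 hk hk0, ← integral_mul_const]
    congr 1 with t
    simp only [hFdef]
    rw [real_inner_smul_left, real_inner_smul_left, hQs, mul_assoc]
  have hG2 := hG.integral_prod_right
  simp_rw [hslice] at hG2
  refine ⟨hG2.integral_prod_left, ?_⟩
  rw [integral_congr_ae hu, ← integral_prod _ hFi, real_inner_comm, ← integral_inner hFi ψ]
  simp_rw [real_inner_comm _ ψ]
  rw [integral_prod_symm _ hG]
  simp_rw [hslice]
  rw [hm, integral_prod _ hG2]

end Duality

section Semigroup

variable {E : Type*} [NormedAddCommGroup E] [NormedSpace ℝ E] [CompleteSpace E]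

/-- A semigroup orbit of an element of the generator's domain is the integral of its derivative. -/
theorem semigroup_apply_eq_add_integral {P : ℝ → E →L[ℝ] E}
    (hP0 : P 0 = ContinuousLinearMap.id ℝ E)
    (hPsemi : ∀ s t : ℝ, 0 ≤ s → 0 ≤ t → P (s + t) = (P s).comp (P t))
    (hPcont : ∀ g, ContinuousOn (fun t => P t g) (Ici (0:ℝ))) {g Lg : E}
    (hL : Tendsto (fun h : ℝ => h⁻¹ • (P h g - g)) (𝓝[>] 0) (𝓝 Lg)) {r : ℝ} (hr : 0 ≤ r) :
    P r g = g + ∫ q in (0:ℝ)..r, P q Lg := by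
  have hsub : uIcc 0 r ⊆ Ici (0:ℝ) := by rw [uIcc_of_le hr]; exact Icc_subset_Ici_self
  have h := intervalIntegral.integral_eq_sub_of_hasDeriv_right (f := fun t => P t g)
    (f' := fun t => P t Lg) (a := 0) (b := r) ((hPcont g).mono hsub) (fun x hx => ?_)
    ((hPcont Lg).mono hsub).intervalIntegrable
  · simp only [hP0, ContinuousLinearMap.id_apply] at h
    rw [h]; abel
  · have hx0 : 0 ≤ x := by rw [min_eq_left hr] at hx; exact hx.1.le
    rw [hasDerivWithinAt_iff_tendsto_slope' self_notMem_Ioi]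
    have h1 : Tendsto (fun y : ℝ => y - x) (𝓝[>] x) (𝓝[>] 0) := by
      refine tendsto_nhdsWithin_iff.2 ⟨?_, ?_⟩
      · have : Tendsto (fun y : ℝ => y - x) (𝓝 x) (𝓝 (x - x)) :=
          (continuous_id.sub continuous_const).tendsto x
        rw [sub_self] at this
        exact this.mono_left nhdsWithin_le_nhds
      · filter_upwards [self_mem_nhdsWithin] with y hy
        exact sub_pos.2 (mem_Ioi.1 hy)
    refine (((P x).continuous.tendsto _).comp (hL.comp h1)).congr' ?_
    filter_upwards [self_mem_nhdsWithin] with y hy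
    have hy0 : 0 ≤ y - x := sub_nonneg.2 (le_of_lt (mem_Ioi.1 hy))
    have : P y = (P x).comp (P (y - x)) := by rw [← hPsemi x _ hx0 hy0]; congr 1; ring
    simp [slope, this]

end Semigroup

theorem ofReal_indicator_one (x : ℝ) :
    ENNReal.ofReal ((Ioi (0:ℝ)).indicator 1 x) = (Ioi (0:ℝ)).indicator 1 x := by
  by_cases hx : 0 < x <;> simp [hx]

theorem lintegral_convLIntegral_one {k : ℝ → ℝ → ℝ≥0∞} (hk : Measurable (Function.uncurry k))
    (x : ℝ) : ∫⁻ q in Ioi (0:ℝ), convLIntegral ((Ioi 0).indicator 1) (k q) x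
      = ∫⁻ y in Iio x, ∫⁻ r in Ioi (0:ℝ), k r y := by
  have h : ∀ q, convLIntegral ((Ioi 0).indicator 1) (k q) x = ∫⁻ y in Iio x, k q y := by
    intro q
    rw [convLIntegral, ← lintegral_indicator measurableSet_Iio]
    refine lintegral_congr fun y => ?_
    by_cases hy : y < x <;> simp [hy]
  simp_rw [h]
  exact lintegral_lintegral_swap hk.aemeasurable

section Duality

variable {E : Type*} [NormedAddCommGroup E] {f : ℝ → E} {k : ℝ → ℝ → ℝ}

theorem lintegral_enorm_mul_convLIntegral_one_ne_top (hk : Measurable (Function.uncurry k))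
    (hpot : ∀ X : ℝ, ∫⁻ y in Iic X, ∫⁻ r in Ioi (0:ℝ), ENNReal.ofReal (k r y) ≠ ⊤)
    (hfi : ∫⁻ s, ‖f s‖ₑ ≠ ⊤) (hf0 : ∀ s ≤ 0, f s = 0) (T : ℝ) :
    ∫⁻ s, ‖f s‖ₑ * ∫⁻ r in Ioi (0:ℝ), convLIntegral
      (fun x => ENNReal.ofReal ((Ioi (0:ℝ)).indicator 1 x))
      (fun y => ENNReal.ofReal (k r y)) (T - s) ≠ ⊤ := by
  simp_rw [ofReal_indicator_one]
  refine ne_top_of_le_ne_top (ENNReal.mul_ne_top hfi (hpot T)) ?_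
  rw [← lintegral_mul_const' _ _ (hpot T)]
  refine lintegral_mono fun s => ?_
  rcases le_or_gt s 0 with hs | hs
  · simp [hf0 s hs]
  · refine mul_le_mul' le_rfl ?_
    refine (lintegral_convLIntegral_one (k := fun r y => ENNReal.ofReal (k r y))
      (by exact hk.ennreal_ofReal) (T - s)).trans_le (lintegral_mono_set ?_)
    intro y hy
    have : y < T - s := hy
    exact mem_Iic.2 (by linarith)

theorem lintegral_enorm_mul_convLIntegral_le {W : ℝ → ℝ}
    (hone : (fun x => ∫⁻ r in Ioi (0:ℝ), convLIntegral (fun x => ENNReal.ofReal (W x))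
      (fun y => ENNReal.ofReal (k r y)) x) =ᵐ[volume] (Ioi 0).indicator 1) (T : ℝ) :
    ∫⁻ s, ‖f s‖ₑ * ∫⁻ r in Ioi (0:ℝ), convLIntegral
      (fun x => ENNReal.ofReal (W x)) (fun y => ENNReal.ofReal (k r y)) (T - s)
      ≤ ∫⁻ s, ‖f s‖ₑ := by
  refine lintegral_mono_ae ?_
  filter_upwards [(Measure.measurePreserving_sub_left volume T).quasiMeasurePreserving.ae hone] with s hs
  rw [hs]
  refine mul_le_of_le_one_right zero_le ?_
  exact indicator_le_self' (by simp) _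

variable [InnerProductSpace ℝ E] [CompleteSpace E] {Q : ℝ → E →L[ℝ] E}

theorem inner_integral_duhamel_eq_of_kernel_identity {W : ℝ → ℝ} (hQ : ∀ r, ‖Q r‖ ≤ 1)
    (hQc : ∀ g, Continuous fun r => Q r g) (hQs : ∀ r, ∀ g h, ⟪Q r g, h⟫ = ⟪g, Q r h⟫)
    (hf : StronglyMeasurable f) (hfi : Integrable f) (hf0 : ∀ s ≤ 0, f s = 0)
    (hk : Measurable (Function.uncurry k)) (hk0 : ∀ r y, 0 ≤ k r y)
    (hW : Measurable W) (hW0 : ∀ x, 0 ≤ W x)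
    (hpot : ∀ X : ℝ, ∫⁻ y in Iic X, ∫⁻ r in Ioi (0:ℝ), ENNReal.ofReal (k r y) ≠ ⊤)
    (hone : (fun x => ∫⁻ r in Ioi (0:ℝ), convLIntegral (fun x => ENNReal.ofReal (W x))
      (fun y => ENNReal.ofReal (k r y)) x) =ᵐ[volume] (Ioi 0).indicator 1)
    (htail : ∀ q : ℝ, 0 < q → (fun x => ∫⁻ r in Ioi q, convLIntegral
      (fun x => ENNReal.ofReal (W x)) (fun y => ENNReal.ofReal (k r y)) x) =ᵐ[volume]
        convLIntegral ((Ioi 0).indicator 1) (fun y => ENNReal.ofReal (k q y)))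
    {g Lg : E} (horb : ∀ r : ℝ, 0 ≤ r → Q r g = g + ∫ q in (0:ℝ)..r, Q q Lg) (T : ℝ) :
    ⟪∫ t, W (T - t) • duhamel Q k f t, g⟫ = (∫ s in Iio T, ⟪f s, g⟫) +
      ⟪∫ t, (Ioi (0:ℝ)).indicator (1 : ℝ → ℝ) (T - t) • duhamel Q k f t, Lg⟫ := by
  have hkE : Measurable (Function.uncurry fun r y => ENNReal.ofReal (k r y)) := hk.ennreal_ofReal
  have h1E : Measurable ((Ioi (0:ℝ)).indicator (1 : ℝ → ℝ≥0∞)) :=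
    measurable_one.indicator measurableSet_Ioi
  have hfi' : ∫⁻ s, ‖f s‖ₑ ≠ ⊤ := hfi.2.ne
  obtain ⟨-, hL⟩ := inner_integral_duhamel hQ hQc hQs hf hk hk0 hW hW0
    (ne_top_of_le_ne_top hfi' (lintegral_enorm_mul_convLIntegral_le hone T)) g
  obtain ⟨hRi, hR⟩ := inner_integral_duhamel (V := (Ioi (0:ℝ)).indicator 1) hQ hQc hQs hf hk hk0
    (measurable_one.indicator measurableSet_Ioi)
    (fun x => indicator_nonneg (by simp) x)
    (lintegral_enorm_mul_convLIntegral_one_ne_top hk hpot hfi' hf0 T) Lg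
  rw [hL, hR]
  simp_rw [ofReal_indicator_one] at hRi ⊢
  have hconv := measurable_convLIntegral_param (k := fun r y => ENNReal.ofReal (k r y))
    hW.ennreal_ofReal hkE
  have hconv1 := measurable_convLIntegral_param (k := fun r y => ENNReal.ofReal (k r y)) h1E hkE
  have htail' : ∀ᵐ x : ℝ, ∀ᵐ q ∂(volume.restrict (Ioi (0:ℝ))),
      ∫⁻ r in Ioi q, convLIntegral (fun x => ENNReal.ofReal (W x))
        (fun y => ENNReal.ofReal (k r y)) x
        = convLIntegral ((Ioi 0).indicator 1) (fun y => ENNReal.ofReal (k q y)) x := by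
    rw [Measure.ae_ae_comm]
    · filter_upwards [ae_restrict_mem measurableSet_Ioi] with q hq
      exact htail q hq
    · refine measurableSet_eq_fun ?_ (hconv1.comp measurable_swap)
      have h : Measurable fun p : (ℝ × ℝ) × ℝ => {p : (ℝ × ℝ) × ℝ | p.1.2 < p.2}.indicator
          (fun p => convLIntegral (fun x => ENNReal.ofReal (W x))
            (fun y => ENNReal.ofReal (k p.2 y)) p.1.1) p := by
        refine Measurable.indicator ?_
          (measurableSet_lt (measurable_snd.comp measurable_fst) measurable_snd)
        exact hconv.comp (by fun_prop : Measurable fun p : (ℝ × ℝ) × ℝ => (p.2, p.1.1))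
      have h2 : Measurable fun p : ℝ × ℝ => ∫⁻ r, {p : (ℝ × ℝ) × ℝ | p.1.2 < p.2}.indicator
          (fun p => convLIntegral (fun x => ENNReal.ofReal (W x))
            (fun y => ENNReal.ofReal (k p.2 y)) p.1.1) (p, r) := h.lintegral_prod_right'
      convert h2 using 2 with p
      rw [← lintegral_indicator measurableSet_Ioi]
      rfl
  have hqmp := (Measure.measurePreserving_sub_left volume T).quasiMeasurePreserving
  have key : ∀ᵐ s : ℝ, ∫ r in Ioi (0:ℝ), (convLIntegral (fun x => ENNReal.ofReal (W x))
        (fun y => ENNReal.ofReal (k r y)) (T - s)).toReal * ⟪f s, Q r g⟫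
      = (Iio T).indicator (fun s => ⟪f s, g⟫) s + ∫ r in Ioi (0:ℝ), (convLIntegral
        ((Ioi 0).indicator 1) (fun y => ENNReal.ofReal (k r y)) (T - s)).toReal
          * ⟪f s, Q r Lg⟫ := by
    filter_upwards [hqmp.ae hone, hqmp.ae htail'] with s hs1 hs2
    have hjm : Measurable fun r => convLIntegral (fun x => ENNReal.ofReal (W x))
        (fun y => ENNReal.ofReal (k r y)) (T - s) :=
      hconv.comp (by fun_prop : Measurable fun r : ℝ => (r, T - s))
    have hQ0 : Q 0 g = g := by simpa using horb 0 le_rfl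
    rw [integral_mul_primitive_eq (a := fun r => ⟪f s, Q r g⟫) (b := fun r => ⟪f s, Q r Lg⟫)
      (B := ‖f s‖ * ‖Lg‖) hjm ?_ hs2 ?_ (by fun_prop) ?_ ?_, hs1, hQ0]
    · congr 1
      by_cases hs : s < T <;> simp [hs]
    · rw [hs1]
      exact ne_top_of_le_ne_top ENNReal.one_ne_top (indicator_le_self' (by simp) _)
    · rw [lintegral_convLIntegral_one (k := fun r y => ENNReal.ofReal (k r y)) hkE]
      exact ne_top_of_le_ne_top (hpot (T - s)) (lintegral_mono_set Iio_subset_Iic_self)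
    · intro q
      refine (abs_real_inner_le_norm _ _).trans ?_
      gcongr
      exact ((Q q).le_of_opNorm_le (hQ q) Lg).trans_eq (one_mul _)
    · intro r hr
      rw [hQ0, horb r hr, inner_add_right]
      congr 1
      exact ((innerSL ℝ (f s)).intervalIntegral_comp_comm
        ((hQc Lg).intervalIntegrable 0 r)).symm
  rw [integral_congr_ae key, integral_add ?_ hRi, integral_indicator measurableSet_Iio]
  exact (hfi.inner_const g).indicator measurableSet_Iio

end Duality

/-- Proposition 2.6(1).  For `f : (0,T₀] → L²(E;μ)` with
`∫₀^{T₀} ‖f(t)‖ dt < ∞`, the function `u(t) = ∫₀^t∫₀^∞ P⁰_r f(s) p̄(r,t−s) dr ds` is well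
defined in `L²` for a.e. `t ∈ (0,T₀]` with `∫₀^{T₀} ‖u‖ dt < ∞`; for every `T ∈ (0,T₀]`,
`∫₀^T w(T−t)‖u(t)‖ dt < ∞`, and for every `φ ∈ 𝒟(𝓛)`,
`⟨∫₀^T w(T−s)u(s) ds, φ⟩ = ∫₀^T ⟨f(s),φ⟩ ds + ∫₀^T ⟨u(s),𝓛φ⟩ ds`. -/
theorem time_frac_stmt5
    {α : Type*} [MeasurableSpace α] (μE : Measure α) [SigmaFinite μE]
    (ν : Measure ℝ)
    (hν_loc : ∫⁻ x in Set.Ioi (0:ℝ), ENNReal.ofReal (min 1 x) ∂ν ≠ ⊤)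
    (hν_inf : ν (Set.Ioi (0:ℝ)) = ⊤)
    (φ : ℝ → ℝ)
    (hφ : ∀ l : ℝ, 0 < l → φ l = ∫ x in Set.Ioi (0:ℝ), (1 - Real.exp (-l * x)) ∂ν)
    (w : ℝ → ℝ)
    (hw : ∀ x : ℝ, w x = (ν (Set.Ioi x)).toReal)
    (μr : ℝ → Measure ℝ)
    (hprob : ∀ r : ℝ, 0 < r → IsProbabilityMeasure (μr r))
    (hlap : ∀ r : ℝ, 0 < r → ∀ l : ℝ, 0 < l →
      ∫ s, Real.exp (-l * s) ∂(μr r) = Real.exp (-r * φ l))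
    (pbar : ℝ → ℝ → ℝ)
    (hpbar_nn : ∀ r t : ℝ, 0 ≤ pbar r t)
    (hpbar_meas : Measurable (Function.uncurry pbar))
    (hpbar_bdd : ∀ r : ℝ, 0 < r → ∃ C : ℝ, ∀ t : ℝ, pbar r t ≤ C)
    (hdens : ∀ r : ℝ, 0 < r → ∀ A : Set ℝ, MeasurableSet A →
      μr r A = ∫⁻ t in A ∩ Set.Ici 0, ENNReal.ofReal (pbar r t))
    -- strongly continuous contraction semigroup of self-adjoint operators on L²(E;μ)
    (P : ℝ → Lp ℝ 2 μE →L[ℝ] Lp ℝ 2 μE)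
    (hP0 : P 0 = ContinuousLinearMap.id ℝ (Lp ℝ 2 μE))
    (hPsemi : ∀ s t : ℝ, 0 ≤ s → 0 ≤ t → P (s + t) = (P s).comp (P t))
    (hPcontr : ∀ t : ℝ, 0 ≤ t → ‖P t‖ ≤ 1)
    (hPcont : ∀ g : Lp ℝ 2 μE, ContinuousOn (fun t => P t g) (Set.Ici (0:ℝ)))
    (hPsym : ∀ t : ℝ, 0 ≤ t → ∀ g h : Lp ℝ 2 μE, ⟪P t g, h⟫ = ⟪g, P t h⟫)
    -- the data f and the candidate solution u
    (T₀ : ℝ) (hT₀ : 0 < T₀)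
    (f : ℝ → Lp ℝ 2 μE)
    (hf_int : IntegrableOn f (Set.Ioc 0 T₀))
    (u : ℝ → Lp ℝ 2 μE)
    (hu : ∀ t : ℝ, u t =
      ∫ s in Set.Ioc (0:ℝ) t, ∫ r in Set.Ioi (0:ℝ), pbar r (t - s) • P r (f s)) :
    (∀ᵐ t ∂(volume.restrict (Set.Ioc (0:ℝ) T₀)),
      IntegrableOn (fun p : ℝ × ℝ => pbar p.2 (t - p.1) • P p.2 (f p.1))
        ((Set.Ioc (0:ℝ) t) ×ˢ (Set.Ioi (0:ℝ)))) ∧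
    IntegrableOn u (Set.Ioc 0 T₀) ∧
    (∀ T ∈ Set.Ioc (0:ℝ) T₀,
      (∫⁻ t in Set.Ioc (0:ℝ) T, ENNReal.ofReal (w (T - t) * ‖u t‖)) ≠ ⊤ ∧
      ∀ φd Lφ : Lp ℝ 2 μE,
        Tendsto (fun h : ℝ => h⁻¹ • (P h φd - φd)) (nhdsWithin 0 (Set.Ioi (0:ℝ)))
          (nhds Lφ) →
        ⟪∫ s in Set.Ioc (0:ℝ) T, w (T - s) • u s, φd⟫
          = (∫ s in Set.Ioc (0:ℝ) T, ⟪f s, φd⟫) + ∫ s in Set.Ioc (0:ℝ) T, ⟪u s, Lφ⟫) := by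
  -- scalar preliminaries on the kernel
  set k : ℝ → ℝ → ℝ := fun r => (Ioi (0:ℝ)).indicator (pbar r) with hkdef
  set W : ℝ → ℝ := (Ioi (0:ℝ)).indicator w with hWdef
  have hk : Measurable (Function.uncurry k) := by
    have h : Measurable ({p : ℝ × ℝ | 0 < p.2}.indicator (Function.uncurry pbar)) :=
      hpbar_meas.indicator (measurableSet_lt measurable_const measurable_snd)
    exact h
  have hk0 : ∀ r y, 0 ≤ k r y := fun r y => indicator_nonneg (fun y _ => hpbar_nn r y) y
  have hkE : Measurable (Function.uncurry fun r y => ENNReal.ofReal (k r y)) := hk.ennreal_ofReal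
  have hw0 : ∀ x, 0 ≤ w x := fun x => by rw [hw]; exact ENNReal.toReal_nonneg
  have hW0 : ∀ x, 0 ≤ W x := fun x => indicator_nonneg (fun x _ => hw0 x) x
  have hW : Measurable W := by
    refine Measurable.indicator ?_ measurableSet_Ioi
    rw [funext hw]
    exact (measurable_measure_Ioi ν).ennreal_toReal
  have hWE : (fun x => ENNReal.ofReal (W x)) = (Ioi 0).indicator fun x => ν (Ioi x) := by
    funext x
    by_cases hx : 0 < x
    · simp [hWdef, hx, hw, ENNReal.ofReal_toReal (measure_Ioi_ne_top hν_loc hx)]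
    · simp [hWdef, hx]
  have hΦ : ∀ l : ℝ, 0 < l → 0 < φ l := fun l hl => by
    rw [hφ l hl]
    exact laplaceExponent_pos hν_loc (by simp [hν_inf]) hl
  have hWlap : ∀ l : ℝ, 0 < l → laplaceLIntegral (fun x => ENNReal.ofReal (W x)) l
      = ENNReal.ofReal (1 / l) * ENNReal.ofReal (φ l) := fun l hl => by
    rw [hWE, laplaceLIntegral_tail hν_loc hl, hφ l hl]
  have hklap : ∀ r : ℝ, 0 < r → ∀ l : ℝ, 0 < l → laplaceLIntegral
      (fun y => ENNReal.ofReal (k r y)) l = ENNReal.ofReal (Real.exp (-r * φ l)) :=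
    fun r hr l hl => laplaceLIntegral_density (hpbar_meas.comp measurable_prodMk_left)
      (hdens r hr) (hlap r hr l hl)
  have hpot := lintegral_potential_ne_top hkE hΦ hklap
  have hone := lintegral_Ioi_zero_conv_ae_eq hkE hW.ennreal_ofReal hΦ hWlap hklap
  have htail := fun (q : ℝ) (hq : 0 < q) =>
    lintegral_Ioi_conv_ae_eq hkE hW.ennreal_ofReal hΦ hWlap hklap hq
  -- the semigroup, extended to all real times
  set Q : ℝ → Lp ℝ 2 μE →L[ℝ] Lp ℝ 2 μE := fun r => P (max r 0) with hQdef
  have hQP : ∀ r, 0 ≤ r → Q r = P r := fun r hr => by rw [hQdef]; simp only [max_eq_left hr]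
  have hQ : ∀ r, ‖Q r‖ ≤ 1 := fun r => hPcontr _ (le_max_right _ _)
  have hQc : ∀ g, Continuous fun r => Q r g := fun g =>
    (hPcont g).comp_continuous (by fun_prop) fun r => mem_Ici.2 (le_max_right _ _)
  have hQs : ∀ r, ∀ g h, ⟪Q r g, h⟫ = ⟪g, Q r h⟫ := fun r => hPsym _ (le_max_right _ _)
  -- a strongly measurable version of the data, vanishing off the time interval
  set f' : ℝ → Lp ℝ 2 μE := (Ioc 0 T₀).indicator (hf_int.1.mk f) with hf'def
  have hf' : StronglyMeasurable f' := hf_int.1.stronglyMeasurable_mk.indicator measurableSet_Ioc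
  have hff' : ∀ᵐ s, s ∈ Ioc 0 T₀ → f s = f' s := by
    filter_upwards [(ae_restrict_iff' measurableSet_Ioc).1 hf_int.1.ae_eq_mk] with s hs hs0
    rw [hs hs0, hf'def, indicator_of_mem hs0]
  have hf'i : Integrable f' :=
    (integrable_indicator_iff measurableSet_Ioc).2 (hf_int.congr hf_int.1.ae_eq_mk)
  have hf'0 : ∀ s ≤ 0, f' s = 0 := fun s hs =>
    indicator_of_notMem (fun h => absurd h.1 (not_lt.2 hs)) _
  have hf'fin : ∫⁻ s, ‖f' s‖ₑ ≠ ⊤ := hf'i.2.ne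
  have hud : ∀ t ∈ Ioc 0 T₀, u t = duhamel Q k f' t := by
    intro t ht
    rw [hu, duhamel, integral_Ioc_eq_integral_Ioo, ← integral_indicator measurableSet_Ioo]
    refine integral_congr_ae ?_
    filter_upwards [hff'] with s hs
    by_cases hst : s ∈ Ioo 0 t
    · rw [indicator_of_mem hst, hs ⟨hst.1, hst.2.le.trans ht.2⟩]
      refine setIntegral_congr_fun measurableSet_Ioi fun r hr => ?_
      have h1 : k r (t - s) = pbar r (t - s) := indicator_of_mem (sub_pos.2 hst.2) _
      simp only [h1, hQP r (le_of_lt hr)]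
    · rw [indicator_of_notMem hst]
      by_cases hs0 : s ≤ 0
      · simp [hf'0 s hs0]
      · have h1 : ∀ r, k r (t - s) = 0 := fun r => indicator_of_notMem
          (fun h => hst ⟨not_le.1 hs0, sub_pos.1 h⟩) _
        simp [h1]
  have hd0 : ∀ t ≤ 0, duhamel Q k f' t = 0 := by
    intro t ht
    have h : ∀ s r, k r (t - s) • Q r (f' s) = 0 := by
      intro s r
      rcases le_or_gt s 0 with hs | hs
      · simp [hf'0 s hs]
      · have h1 : k r (t - s) = 0 := indicator_of_notMem
          (fun h => absurd (mem_Ioi.1 h) (by linarith)) _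
        simp [h1]
    simp [duhamel, h]
  -- the majorant is integrable in time
  have hmaj : ∀ T, ∫⁻ t, (Ioi (0:ℝ)).indicator 1 (T - t) * duhamelMajorant k f' t ≠ ⊤ := by
    intro T
    rw [lintegral_mul_duhamelMajorant (measurable_one.indicator measurableSet_Ioi) hf' hk]
    have h := lintegral_enorm_mul_convLIntegral_one_ne_top hk hpot hf'fin hf'0 T
    simp_rw [ofReal_indicator_one] at h
    exact h
  have hmaj' : ∫⁻ t in Ioc 0 T₀, duhamelMajorant k f' t ≠ ⊤ := by
    refine ne_top_of_le_ne_top (hmaj (T₀ + 1)) ?_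
    rw [← lintegral_indicator measurableSet_Ioc]
    refine lintegral_mono fun t => ?_
    by_cases ht : t ∈ Ioc 0 T₀
    · have h1 : T₀ + 1 - t ∈ Ioi (0:ℝ) := by
        have := ht.2
        exact mem_Ioi.2 (by linarith)
      rw [indicator_of_mem ht, indicator_of_mem h1, Pi.one_apply, one_mul]
    · rw [indicator_of_notMem ht]; exact zero_le
  have hmajm : Measurable (duhamelMajorant k f') := by
    have h := ((measurable_kernel_ofReal hf' hk).comp
      (by fun_prop : Measurable fun q : (ℝ × ℝ) × ℝ => (q.1.1, q.1.2, q.2)))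
    exact (h.lintegral_prod_right' (ν := volume.restrict (Ioi (0:ℝ)))).lintegral_prod_right'
  have hdi : IntegrableOn (duhamel Q k f') (Ioc 0 T₀) := by
    refine ⟨(stronglyMeasurable_duhamel hQ hQc hf' hk).aestronglyMeasurable, ?_⟩
    exact lt_of_le_of_lt (lintegral_mono fun t => enorm_duhamel_le hQ hk0 t) hmaj'.lt_top
  have hui : IntegrableOn u (Ioc 0 T₀) :=
    hdi.congr_fun (fun t ht => (hud t ht).symm) measurableSet_Ioc
  refine ⟨?_, hui, ?_⟩
  · filter_upwards [ae_lt_top hmajm hmaj', ae_restrict_mem measurableSet_Ioc] with t ht ht0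
    have hi := integrable_kernel_smul hQ hQc hf' hk hk0 ht.ne
    rw [IntegrableOn, Measure.volume_eq_prod, ← Measure.prod_restrict]
    refine (hi.mono_measure (Measure.prod_mono Measure.restrict_le_self le_rfl)).congr ?_
    have h1 : ∀ᵐ s ∂(volume.restrict (Ioc 0 t)), s ∈ Ioo 0 t ∧ f s = f' s := by
      rw [restrict_Ioo_eq_restrict_Ioc.symm]
      filter_upwards [ae_restrict_mem measurableSet_Ioo, ae_restrict_of_ae hff'] with s hs hs'
      exact ⟨hs, hs' ⟨hs.1, hs.2.le.trans ht0.2⟩⟩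
    have h2 : ∀ᵐ r ∂(volume.restrict (Ioi (0:ℝ))), 0 < r := ae_restrict_mem measurableSet_Ioi
    filter_upwards [Measure.quasiMeasurePreserving_fst.ae h1,
      Measure.quasiMeasurePreserving_snd.ae h2] with p hp1 hp2
    have h3 : k p.2 (t - p.1) = pbar p.2 (t - p.1) := indicator_of_mem (sub_pos.2 hp1.1.2) _
    rw [h3, hQP _ hp2.le, hp1.2]
  · intro T hT
    have hmem : ∀ t ∈ Ioo 0 T, t ∈ Ioc 0 T₀ := fun t ht => ⟨ht.1, ht.2.le.trans hT.2⟩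
    refine ⟨?_, fun g Lg hL => ?_⟩
    · have hle := lintegral_enorm_mul_convLIntegral_le (f := f') hone T
      rw [← lintegral_mul_duhamelMajorant hW.ennreal_ofReal hf' hk] at hle
      refine ne_top_of_le_ne_top hf'fin (le_trans ?_ hle)
      rw [setLIntegral_congr Ioo_ae_eq_Ioc.symm, ← lintegral_indicator measurableSet_Ioo]
      refine lintegral_mono fun t => ?_
      by_cases ht : t ∈ Ioo 0 T
      · have h1 : W (T - t) = w (T - t) := indicator_of_mem (sub_pos.2 ht.2) _
        rw [indicator_of_mem ht, ENNReal.ofReal_mul (hw0 _), ofReal_norm, hud t (hmem t ht), h1]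
        exact mul_le_mul' le_rfl (enorm_duhamel_le hQ hk0 t)
      · rw [indicator_of_notMem ht]; exact zero_le
    · have horb : ∀ r : ℝ, 0 ≤ r → Q r g = g + ∫ q in (0:ℝ)..r, Q q Lg := by
        intro r hr
        rw [hQP r hr, semigroup_apply_eq_add_integral hP0 hPsemi hPcont hL hr]
        congr 1
        refine intervalIntegral.integral_congr fun q hq => ?_
        rw [uIcc_of_le hr] at hq
        simp only [hQP q hq.1]
      have hmain := inner_integral_duhamel_eq_of_kernel_identity hQ hQc hQs hf' hf'i hf'0 hk hk0
        hW hW0 hpot hone htail horb T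
      have hcut : ∀ V : ℝ → ℝ, ∫ s in Ioc 0 T, V (T - s) • u s
          = ∫ t, (Ioi (0:ℝ)).indicator V (T - t) • duhamel Q k f' t := by
        intro V
        rw [integral_Ioc_eq_integral_Ioo, ← integral_indicator measurableSet_Ioo]
        refine integral_congr_ae (ae_of_all _ fun t => ?_)
        by_cases ht : t ∈ Ioo 0 T
        · have h1 : (Ioi (0:ℝ)).indicator V (T - t) = V (T - t) :=
            indicator_of_mem (sub_pos.2 ht.2) _
          simp only [indicator_of_mem ht, h1, hud t (hmem t ht)]
        · simp only [indicator_of_notMem ht]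
          by_cases ht0 : t ≤ 0
          · rw [hd0 t ht0, smul_zero]
          · have hTt : T - t ∉ Ioi (0:ℝ) := fun h => ht ⟨not_le.1 ht0, sub_pos.1 h⟩
            rw [indicator_of_notMem hTt, zero_smul]
      have hdata : ∫ s in Ioc 0 T, ⟪f s, g⟫ = ∫ s in Iio T, ⟪f' s, g⟫ := by
        rw [integral_Ioc_eq_integral_Ioo, ← integral_indicator measurableSet_Ioo,
          ← integral_indicator measurableSet_Iio]
        refine integral_congr_ae ?_
        filter_upwards [hff'] with s hs
        by_cases hsT : s ∈ Ioo 0 T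
        · rw [indicator_of_mem hsT, indicator_of_mem (by exact hsT.2), hs (hmem s hsT)]
        · rw [indicator_of_notMem hsT]
          by_cases hs0 : s ≤ 0
          · simp [indicator_apply, hf'0 s hs0]
          · have hTs : s ∉ Iio T := fun h => hsT ⟨not_le.1 hs0, h⟩
            rw [indicator_of_notMem hTs]
      have hone' := hcut 1
      simp only [Pi.one_apply, one_smul] at hone'
      rw [hcut w, hmain, hdata, ← hone', real_inner_comm,
        ← integral_inner (hui.mono_set (Ioc_subset_Ioc_right hT.2))]
      simp_rw [real_inner_comm Lg]
end

section
/- Let T₀ ∈ (0,∞) and f : (0,T₀] → L²(E;μ) with ‖f(t)‖_{L²} ≤ K < ∞ for a.e. t ∈ (0,T₀]. Then u(t) := ∫₀^t ∫₀^∞ P⁰_r f(s) p̄(r, t−s) dr ds is well defined in L²(E;μ) for every t ∈ (0,T₀], the map t ↦ u(t) is continuous in L², sup_{t∈(0,T₀]} ‖u(t)‖_{L²} < ∞, and u(t) → 0 in L² as t ↓ 0. If in addition f(t) ∈ 𝒟(𝓛) for a.e. t ∈ (0,T₀] with ‖𝓛f(t)‖_{L²} ≤ K for a.e. t, then t ↦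 𝓛u(t) is continuous in L²(E;μ). -/
open MeasureTheory Filter Set
open scoped ENNReal Topology RealInnerProductSpace

section Translation

variable {G : Type*} [AddCommGroup G] [TopologicalSpace G] [IsTopologicalAddGroup G]
  [R1Space G] [MeasurableSpace G] [BorelSpace G]
  {m : Measure G} [IsLocallyFiniteMeasure m] [m.InnerRegularCompactLTTop] [m.IsAddLeftInvariant]
  {X : Type*} [NormedAddCommGroup X] [NormedSpace ℝ X]

/-- Pairing the translates of an integrable scalar function with a bounded function depends
continuously on the translation parameter. -/
theorem continuous_integral_translate_smul {Q : G → ℝ} (hQ : Integrable Q m) {F : G → X}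
    (hF : AEStronglyMeasurable F m) {C : ℝ} (hFC : ∀ᵐ p ∂m, ‖F p‖ ≤ C) :
    Continuous fun a : G => ∫ p, Q (a + p) • F p ∂m := by
  have hQa (a : G) : Integrable (fun p => Q (a + p)) m := hQ.comp_add_left a
  have hint (a : G) : Integrable (fun p => Q (a + p) • F p) m :=
    (hQa a).smul_bdd C hF hFC
  let q : Lp ℝ 1 m := hQ.toL1 Q
  have : Fact ((1 : ℝ≥0∞) ≠ ∞) := ⟨ENNReal.one_ne_top⟩
  have hcont : Continuous fun a : G => DomAddAct.mk a +ᵥ q :=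
    (DomAddAct.continuous_mk).vadd continuous_const
  have hcoe (a : G) : (DomAddAct.mk a +ᵥ q : Lp ℝ 1 m) =ᵐ[m] fun p => Q (a + p) :=
    (DomAddAct.vadd_Lp_ae_eq (DomAddAct.mk a) q).trans <|
      (measurePreserving_add_left m a).quasiMeasurePreserving.ae_eq_comp hQ.coeFn_toL1
  rw [continuous_iff_continuousAt]
  intro a
  have hlim : Tendsto (fun b => |C| * ‖(DomAddAct.mk b +ᵥ q) - (DomAddAct.mk a +ᵥ q)‖)
      (𝓝 a) (𝓝 0) := by
    have h : Continuous fun b => |C| * ‖(DomAddAct.mk b +ᵥ q) - (DomAddAct.mk a +ᵥ q)‖ :=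
      (hcont.sub continuous_const).norm.const_mul |C|
    exact h.tendsto' a 0 (by simp)
  refine tendsto_iff_norm_sub_tendsto_zero.2
    (squeeze_zero (fun _ => norm_nonneg _) (fun b => ?_) hlim)
  rw [← integral_sub (hint b) (hint a), L1.norm_eq_integral_norm, ← integral_const_mul]
  refine norm_integral_le_of_norm_le ((L1.integrable_coeFn _).norm.const_mul _) ?_
  filter_upwards [hFC, hcoe a, hcoe b,
    Lp.coeFn_sub (DomAddAct.mk b +ᵥ q) (DomAddAct.mk a +ᵥ q)] with p hp ha hb hab
  rw [hab, Pi.sub_apply, ha, hb, ← sub_smul, norm_smul, mul_comm]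
  gcongr
  exact hp.trans (le_abs_self C)

end Translation

section Semigroup

variable {X : Type*} [NormedAddCommGroup X] [NormedSpace ℝ X]

theorem aestronglyMeasurable_semigroup_apply {P : ℝ → X →L[ℝ] X}
    (hPcont : ∀ g : X, ContinuousOn (fun t => P t g) (Ici (0 : ℝ)))
    {s : Set ℝ} {f : ℝ → X} (hf : AEStronglyMeasurable f (volume.restrict s)) :
    AEStronglyMeasurable (fun p : ℝ × ℝ => P p.2 (f p.1))
      (volume.restrict (s ×ˢ Ioi (0 : ℝ))) := by
  obtain ⟨g, hg, hfg⟩ := hf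
  rw [Measure.volume_eq_prod, ← Measure.prod_restrict]
  have hjoint : StronglyMeasurable (Function.uncurry fun r a : ℝ => P (max r 0) (g a)) := by
    refine stronglyMeasurable_uncurry_of_continuous_of_stronglyMeasurable (fun a => ?_)
      (fun r => (P (max r 0)).continuous.comp_stronglyMeasurable hg)
    exact (hPcont (g a)).comp_continuous (by fun_prop) fun r => le_max_right r 0
  refine ⟨_, hjoint.comp_measurable measurable_swap, ?_⟩
  filter_upwards [Measure.quasiMeasurePreserving_fst.ae hfg,
    Measure.quasiMeasurePreserving_snd.ae (ae_restrict_mem measurableSet_Ioi)] with p h1 h2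
  simp [Function.uncurry, h1, max_eq_left (mem_Ioi.1 h2).le]

theorem norm_semigroup_sub_self_le {P : ℝ → X →L[ℝ] X}
    (hP0 : P 0 = ContinuousLinearMap.id ℝ X)
    (hPsemi : ∀ s t : ℝ, 0 ≤ s → 0 ≤ t → P (s + t) = (P s).comp (P t))
    (hPcontr : ∀ t : ℝ, 0 ≤ t → ‖P t‖ ≤ 1)
    (hPcont : ∀ g : X, ContinuousOn (fun t => P t g) (Ici (0 : ℝ)))
    {g Lg : X} (hL : Tendsto (fun h : ℝ => h⁻¹ • (P h g - g)) (𝓝[>] 0) (𝓝 Lg))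
    {h : ℝ} (hh : 0 ≤ h) : ‖P h g - g‖ ≤ ‖Lg‖ * h := by
  have hderiv : ∀ t ∈ Ico 0 h, HasDerivWithinAt (fun t => P t g) (P t Lg) (Ici t) t := by
    intro t ht
    rw [← hasDerivWithinAt_Ioi_iff_Ici, hasDerivWithinAt_iff_tendsto_slope' (by simp)]
    have hshift : Tendsto (fun x : ℝ => x - t) (𝓝[>] t) (𝓝[>] 0) := by
      refine tendsto_nhdsWithin_of_tendsto_nhds_of_eventually_within _ ?_ ?_
      · exact tendsto_nhdsWithin_of_tendsto_nhds
          ((by fun_prop : Continuous fun x : ℝ => x - t).tendsto' t 0 (sub_self t))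
      · filter_upwards [self_mem_nhdsWithin] with x hx
        exact mem_Ioi.2 (sub_pos.2 (mem_Ioi.1 hx))
    refine (((P t).continuous.tendsto Lg).comp (hL.comp hshift)).congr' ?_
    filter_upwards [self_mem_nhdsWithin] with x hx
    have hx' : P x = (P t).comp (P (x - t)) := by
      rw [← hPsemi t (x - t) ht.1 (sub_pos.2 (mem_Ioi.1 hx)).le, add_sub_cancel]
    simp [slope, hx']
  have key := norm_image_sub_le_of_norm_deriv_right_le_segment
    ((hPcont g).mono Icc_subset_Ici_self) hderiv (C := ‖Lg‖)
    (fun t ht => ((P t).le_of_opNorm_le (hPcontr t ht.1) Lg).trans (one_mul _).le)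
    h ⟨hh, le_rfl⟩
  simpa [hP0] using key

end Semigroup

section Subordinator

theorem integral_one_sub_exp_pos {ν : Measure ℝ}
    (hν_loc : ∫⁻ x in Ioi (0 : ℝ), ENNReal.ofReal (min 1 x) ∂ν ≠ ⊤)
    (hν_inf : ν (Ioi (0 : ℝ)) = ⊤) :
    0 < ∫ x in Ioi (0 : ℝ), (1 - Real.exp (-1 * x)) ∂ν := by
  have hnn : ∀ᵐ x ∂(ν.restrict (Ioi (0 : ℝ))), 0 ≤ 1 - Real.exp (-1 * x) := by
    filter_upwards [ae_restrict_mem measurableSet_Ioi] with x hx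
    have : Real.exp (-1 * x) ≤ 1 := Real.exp_le_one_iff.2 (by linarith [mem_Ioi.1 hx])
    linarith
  have hint : Integrable (fun x : ℝ => 1 - Real.exp (-1 * x)) (ν.restrict (Ioi 0)) := by
    refine ⟨by fun_prop, ?_⟩
    rw [hasFiniteIntegral_iff_ofReal hnn]
    refine lt_of_le_of_lt (lintegral_mono fun x => ENNReal.ofReal_le_ofReal ?_)
      (lt_top_iff_ne_top.2 hν_loc)
    refine le_min ?_ ?_
    · linarith [Real.exp_pos (-1 * x)]
    · linarith [Real.add_one_le_exp (-1 * x)]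
  rw [integral_pos_iff_support_of_nonneg_ae hnn hint]
  have hsub : Ioi (0 : ℝ) ⊆ Function.support fun x : ℝ => 1 - Real.exp (-1 * x) := by
    intro x hx
    have : Real.exp (-1 * x) < 1 := by
      simpa using mem_Ioi.1 hx
    exact (sub_pos.2 this).ne'
  refine lt_of_lt_of_le ?_ (measure_mono hsub)
  rw [Measure.restrict_apply_self, hν_inf]
  exact ENNReal.coe_lt_top

theorem measure_Icc_le_of_laplace {m : Measure ℝ} [IsFiniteMeasure m] {c : ℝ} (hc : 0 < c)
    (hm : ∫ s, Real.exp (-1 * s) ∂m = c) (T : ℝ) :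
    m (Icc 0 T) ≤ ENNReal.ofReal (Real.exp T * c) := by
  have hint : Integrable (fun s : ℝ => Real.exp (-1 * s)) m := by
    by_contra h
    rw [integral_undef h] at hm
    exact hc.ne hm
  have h := mul_meas_ge_le_integral_of_nonneg
    (ae_of_all _ fun s : ℝ => (Real.exp_pos (-1 * s)).le) hint (Real.exp (-T))
  have hsub : Icc 0 T ⊆ {s : ℝ | Real.exp (-T) ≤ Real.exp (-1 * s)} := by
    intro s hs
    simpa using hs.2
  have hle : Real.exp (-T) * m.real (Icc 0 T) ≤ c :=
    (mul_le_mul_of_nonneg_left (measureReal_mono hsub) (Real.exp_pos _).le).trans (hm ▸ h)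
  rw [← ofReal_measureReal]
  refine ENNReal.ofReal_le_ofReal ?_
  rw [Real.exp_neg, inv_mul_le_iff₀ (Real.exp_pos T)] at hle
  exact hle

/-- The density of the potential measure, cut off to times in `[0, T]` and reflected in time, is
integrable in `(s, r)`. -/
theorem integrable_indicator_density {pbar : ℝ → ℝ → ℝ} {μr : ℝ → Measure ℝ} {c : ℝ} (hc : 0 < c)
    (hprob : ∀ r : ℝ, 0 < r → IsProbabilityMeasure (μr r))
    (hlap : ∀ r : ℝ, 0 < r → ∫ s, Real.exp (-1 * s) ∂(μr r) = Real.exp (-r * c))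
    (hpbar_nn : ∀ r t : ℝ, 0 ≤ pbar r t)
    (hpbar_meas : Measurable (Function.uncurry pbar))
    (hdens : ∀ r : ℝ, 0 < r → ∀ A : Set ℝ, MeasurableSet A →
      μr r A = ∫⁻ t in A ∩ Ici 0, ENNReal.ofReal (pbar r t)) (T : ℝ) :
    Integrable (indicator (Icc (-T) 0 ×ˢ Ioi 0) fun p : ℝ × ℝ => pbar p.2 (-p.1)) := by
  have hmeas : Measurable fun p : ℝ × ℝ => pbar p.2 (-p.1) :=
    hpbar_meas.comp (measurable_snd.prodMk measurable_fst.neg)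
  rw [integrable_indicator_iff (measurableSet_Icc.prod measurableSet_Ioi)]
  refine ⟨hmeas.aestronglyMeasurable, ?_⟩
  rw [hasFiniteIntegral_iff_ofReal (ae_of_all _ fun p => hpbar_nn _ _), Measure.volume_eq_prod,
    ← Measure.prod_restrict, lintegral_prod_symm' _ hmeas.ennreal_ofReal]
  have hexp : IntegrableOn (fun r : ℝ => Real.exp T * Real.exp (-r * c)) (Ioi 0) := by
    refine Integrable.const_mul ?_ _
    simpa [IntegrableOn, mul_comm] using integrableOn_exp_mul_Ioi (neg_lt_zero.2 hc) 0
  refine lt_of_le_of_lt (setLIntegral_mono' measurableSet_Ioi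
    (g := fun r => ENNReal.ofReal (Real.exp T * Real.exp (-r * c))) fun r hr => ?_) ?_
  · have := hprob r hr
    refine le_trans (le_of_eq ?_) (measure_Icc_le_of_laplace (Real.exp_pos _) (hlap r hr) T)
    rw [hdens r hr _ measurableSet_Icc, inter_eq_left.2 Icc_subset_Ici_self,
      ← (Measure.measurePreserving_neg (volume : Measure ℝ)).setLIntegral_comp_preimage
        measurableSet_Icc (hpbar_meas.of_uncurry_left.ennreal_ofReal)]
    simp
  · exact (hasFiniteIntegral_iff_ofReal (ae_of_all _ fun r => by positivity)).1 hexp.2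

end Subordinator

section Representation

variable {X : Type*} [NormedAddCommGroup X] [NormedSpace ℝ X]

theorem indicator_kernel_smul_eq (pbar : ℝ → ℝ → ℝ) (F : ℝ × ℝ → X) {T t : ℝ}
    (ht : t ≤ T) :
    (fun p : ℝ × ℝ =>
      indicator (Icc (-T) 0 ×ˢ Ioi 0) (fun p : ℝ × ℝ => pbar p.2 (-p.1)) ((-t, 0) + p) •
        indicator (Ioc 0 T ×ˢ Ioi 0) F p) =
      indicator (Ioc 0 t ×ˢ Ioi 0) fun p => pbar p.2 (t - p.1) • F p := by
  funext ⟨s, r⟩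
  by_cases hmem : (s, r) ∈ Ioc 0 t ×ˢ Ioi (0 : ℝ)
  · obtain ⟨⟨h0, h1⟩, hr⟩ := hmem
    simp only at h0 h1
    simp only [mem_Ioi] at hr
    have hA : ((-t, 0) + (s, r) : ℝ × ℝ) ∈ Icc (-T) 0 ×ˢ Ioi (0 : ℝ) :=
      ⟨⟨by simp; linarith, by simp; linarith⟩, by simpa using hr⟩
    have hB : (s, r) ∈ Ioc 0 T ×ˢ Ioi (0 : ℝ) := ⟨⟨h0, h1.trans ht⟩, hr⟩
    have hC : (s, r) ∈ Ioc 0 t ×ˢ Ioi (0 : ℝ) := ⟨⟨h0, h1⟩, hr⟩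
    rw [indicator_of_mem hA, indicator_of_mem hB, indicator_of_mem hC]
    simp [sub_eq_add_neg, add_comm]
  · rw [indicator_of_notMem hmem]
    by_cases hB : (s, r) ∈ Ioc 0 T ×ˢ Ioi (0 : ℝ)
    · have hA : ((-t, 0) + (s, r) : ℝ × ℝ) ∉ Icc (-T) 0 ×ˢ Ioi (0 : ℝ) := by
        intro hA
        have h1 : -t + s ≤ 0 := hA.1.2
        exact hmem ⟨⟨hB.1.1, show s ≤ t by linarith⟩, hB.2⟩
      rw [indicator_of_notMem hA, zero_smul]
    · rw [indicator_of_notMem hB, smul_zero]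

theorem ae_norm_indicator_semigroup_le {P : ℝ → X →L[ℝ] X}
    (hPcontr : ∀ t : ℝ, 0 ≤ t → ‖P t‖ ≤ 1) {s : Set ℝ} (hs : MeasurableSet s)
    {f : ℝ → X} {K : ℝ} (hfK : ∀ᵐ a ∂(volume.restrict s), ‖f a‖ ≤ K) :
    ∀ᵐ p : ℝ × ℝ, ‖indicator (s ×ˢ Ioi 0) (fun p : ℝ × ℝ => P p.2 (f p.1)) p‖ ≤ |K| := by
  have h := Measure.quasiMeasurePreserving_fst (μ := (volume : Measure ℝ))
    (ν := (volume : Measure ℝ)) |>.ae ((ae_restrict_iff' hs).1 hfK)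
  filter_upwards [h] with p hp
  by_cases hmem : p ∈ s ×ˢ Ioi (0 : ℝ)
  · rw [indicator_of_mem hmem]
    refine ((P p.2).le_of_opNorm_le (hPcontr _ (le_of_lt hmem.2)) _).trans ?_
    rw [one_mul]
    exact (hp hmem.1).trans (le_abs_self K)
  · rw [indicator_of_notMem hmem, norm_zero]
    exact abs_nonneg K

end Representation

/-- Proposition 2.6(2).  If `‖f(t)‖_{L²} ≤ K` for a.e. `t ∈ (0,T₀]`, then
`u(t) = ∫₀^t∫₀^∞ P⁰_r f(s) p̄(r,t−s) dr ds` is well defined in `L²(E;μ)` for every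
`t ∈ (0,T₀]`, `t ↦ u(t)` is continuous in `L²`, `sup_{t∈(0,T₀]}‖u(t)‖ < ∞`, and `u(t) → 0`
as `t ↓ 0`.  If moreover `f(t) ∈ 𝒟(𝓛)` a.e. with `‖𝓛f(t)‖ ≤ K` a.e., then `t ↦ 𝓛u(t)`
is continuous in `L²`. -/
theorem time_frac_stmt6
    {α : Type*} [MeasurableSpace α] (μE : Measure α) [SigmaFinite μE]
    (ν : Measure ℝ)
    (hν_loc : ∫⁻ x in Set.Ioi (0:ℝ), ENNReal.ofReal (min 1 x) ∂ν ≠ ⊤)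
    (hν_inf : ν (Set.Ioi (0:ℝ)) = ⊤)
    (φ : ℝ → ℝ)
    (hφ : ∀ l : ℝ, 0 < l → φ l = ∫ x in Set.Ioi (0:ℝ), (1 - Real.exp (-l * x)) ∂ν)
    (w : ℝ → ℝ)
    (hw : ∀ x : ℝ, w x = (ν (Set.Ioi x)).toReal)
    (μr : ℝ → Measure ℝ)
    (hprob : ∀ r : ℝ, 0 < r → IsProbabilityMeasure (μr r))
    (hlap : ∀ r : ℝ, 0 < r → ∀ l : ℝ, 0 < l →
      ∫ s, Real.exp (-l * s) ∂(μr r) = Real.exp (-r * φ l))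
    (pbar : ℝ → ℝ → ℝ)
    (hpbar_nn : ∀ r t : ℝ, 0 ≤ pbar r t)
    (hpbar_meas : Measurable (Function.uncurry pbar))
    (hpbar_bdd : ∀ r : ℝ, 0 < r → ∃ C : ℝ, ∀ t : ℝ, pbar r t ≤ C)
    (hdens : ∀ r : ℝ, 0 < r → ∀ A : Set ℝ, MeasurableSet A →
      μr r A = ∫⁻ t in A ∩ Set.Ici 0, ENNReal.ofReal (pbar r t))
    -- strongly continuous contraction semigroup of self-adjoint operators on L²(E;μ)
    (P : ℝ → Lp ℝ 2 μE →L[ℝ] Lp ℝ 2 μE)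
    (hP0 : P 0 = ContinuousLinearMap.id ℝ (Lp ℝ 2 μE))
    (hPsemi : ∀ s t : ℝ, 0 ≤ s → 0 ≤ t → P (s + t) = (P s).comp (P t))
    (hPcontr : ∀ t : ℝ, 0 ≤ t → ‖P t‖ ≤ 1)
    (hPcont : ∀ g : Lp ℝ 2 μE, ContinuousOn (fun t => P t g) (Set.Ici (0:ℝ)))
    (hPsym : ∀ t : ℝ, 0 ≤ t → ∀ g h : Lp ℝ 2 μE, ⟪P t g, h⟫ = ⟪g, P t h⟫)
    -- data
    (T₀ : ℝ) (hT₀ : 0 < T₀)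
    (f : ℝ → Lp ℝ 2 μE)
    (hf_meas : AEStronglyMeasurable f (volume.restrict (Set.Ioc (0:ℝ) T₀)))
    (K : ℝ)
    (hfK : ∀ᵐ s ∂(volume.restrict (Set.Ioc (0:ℝ) T₀)), ‖f s‖ ≤ K)
    (u : ℝ → Lp ℝ 2 μE)
    (hu : ∀ t : ℝ, u t =
      ∫ s in Set.Ioc (0:ℝ) t, ∫ r in Set.Ioi (0:ℝ), pbar r (t - s) • P r (f s)) :
    (∀ t ∈ Set.Ioc (0:ℝ) T₀,
      IntegrableOn (fun p : ℝ × ℝ => pbar p.2 (t - p.1) • P p.2 (f p.1))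
        ((Set.Ioc (0:ℝ) t) ×ˢ (Set.Ioi (0:ℝ)))) ∧
    ContinuousOn u (Set.Ioc (0:ℝ) T₀) ∧
    (∃ C : ℝ, ∀ t ∈ Set.Ioc (0:ℝ) T₀, ‖u t‖ ≤ C) ∧
    Tendsto u (nhdsWithin 0 (Set.Ioi (0:ℝ))) (nhds 0) ∧
    (∀ Lf : ℝ → Lp ℝ 2 μE,
      (∀ᵐ t ∂(volume.restrict (Set.Ioc (0:ℝ) T₀)),
        Tendsto (fun h : ℝ => h⁻¹ • (P h (f t) - f t)) (nhdsWithin 0 (Set.Ioi (0:ℝ)))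
          (nhds (Lf t))) →
      (∀ᵐ t ∂(volume.restrict (Set.Ioc (0:ℝ) T₀)), ‖Lf t‖ ≤ K) →
      ∃ Lu : ℝ → Lp ℝ 2 μE,
        (∀ t ∈ Set.Ioc (0:ℝ) T₀,
          Tendsto (fun h : ℝ => h⁻¹ • (P h (u t) - u t)) (nhdsWithin 0 (Set.Ioi (0:ℝ)))
            (nhds (Lu t))) ∧
        ContinuousOn Lu (Set.Ioc (0:ℝ) T₀)) := by
  have hc : 0 < φ 1 := by
    rw [hφ 1 one_pos]
    exact integral_one_sub_exp_pos hν_loc hν_inf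
  set Q : ℝ × ℝ → ℝ :=
    indicator (Icc (-T₀) 0 ×ˢ Ioi 0) (fun p : ℝ × ℝ => pbar p.2 (-p.1)) with hQdef
  have hQ : Integrable Q := integrable_indicator_density hc hprob
    (fun r hr => hlap r hr 1 one_pos) hpbar_nn hpbar_meas hdens T₀
  have hQt (t : ℝ) : Integrable fun p : ℝ × ℝ => Q ((-t, 0) + p) := hQ.comp_add_left _
  have hST : MeasurableSet (Ioc 0 T₀ ×ˢ Ioi (0 : ℝ)) :=
    measurableSet_Ioc.prod measurableSet_Ioi
  let I (g : ℝ → Lp ℝ 2 μE) : ℝ × ℝ → Lp ℝ 2 μE :=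
    indicator (Ioc 0 T₀ ×ˢ Ioi 0) fun p => P p.2 (g p.1)
  have hIm {g : ℝ → Lp ℝ 2 μE}
      (hg : AEStronglyMeasurable g (volume.restrict (Ioc (0 : ℝ) T₀))) :
      AEStronglyMeasurable (I g) volume :=
    (aestronglyMeasurable_indicator_iff hST).2 (aestronglyMeasurable_semigroup_apply hPcont hg)
  have hIb {g : ℝ → Lp ℝ 2 μE} (hg : ∀ᵐ s ∂(volume.restrict (Ioc (0 : ℝ) T₀)), ‖g s‖ ≤ K) :
      ∀ᵐ p : ℝ × ℝ, ‖I g p‖ ≤ |K| :=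
    ae_norm_indicator_semigroup_le hPcontr measurableSet_Ioc hg
  let V (g : ℝ → Lp ℝ 2 μE) (t : ℝ) : Lp ℝ 2 μE := ∫ p, Q ((-t, 0) + p) • I g p
  have hVcont {g : ℝ → Lp ℝ 2 μE}
      (hg : AEStronglyMeasurable g (volume.restrict (Ioc (0 : ℝ) T₀)))
      (hgK : ∀ᵐ s ∂(volume.restrict (Ioc (0 : ℝ) T₀)), ‖g s‖ ≤ K) : Continuous (V g) :=
    (continuous_integral_translate_smul hQ (hIm hg) (hIb hgK)).comp
      (by fun_prop : Continuous fun t : ℝ => ((-t, 0) : ℝ × ℝ))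
  have hVint (t : ℝ) {g : ℝ → Lp ℝ 2 μE}
      (hg : AEStronglyMeasurable g (volume.restrict (Ioc (0 : ℝ) T₀)))
      (hgK : ∀ᵐ s ∂(volume.restrict (Ioc (0 : ℝ) T₀)), ‖g s‖ ≤ K) :
      Integrable fun p : ℝ × ℝ => Q ((-t, 0) + p) • I g p :=
    (hQt t).smul_bdd _ (hIm hg) (hIb hgK)
  have hint : ∀ t ≤ T₀,
      IntegrableOn (fun p : ℝ × ℝ => pbar p.2 (t - p.1) • P p.2 (f p.1))
        (Ioc (0 : ℝ) t ×ˢ Ioi (0 : ℝ)) := by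
    intro t ht
    have h := hVint t hf_meas hfK
    rw [indicator_kernel_smul_eq pbar (fun p => P p.2 (f p.1)) ht,
      integrable_indicator_iff (measurableSet_Ioc.prod measurableSet_Ioi)] at h
    exact h
  have huV : ∀ t ≤ T₀, u t = V f t := by
    intro t ht
    change u t = ∫ p, _
    rw [indicator_kernel_smul_eq pbar (fun p => P p.2 (f p.1)) ht,
      integral_indicator (measurableSet_Ioc.prod measurableSet_Ioi), Measure.volume_eq_prod,
      setIntegral_prod _ (hint t ht), hu t]
  have hVf := hVcont hf_meas hfK
  have hV0 : V f 0 = 0 := by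
    rw [← huV 0 hT₀.le, hu 0]
    simp
  refine ⟨fun t ht => hint t ht.2, hVf.continuousOn.congr fun t ht => huV t ht.2, ?_, ?_, ?_⟩
  · obtain ⟨C, hC⟩ := (isCompact_Icc (a := 0) (b := T₀)).exists_bound_of_continuousOn
      hVf.continuousOn
    exact ⟨C, fun t ht => huV t ht.2 ▸ hC t (Ioc_subset_Icc_self ht)⟩
  · have h : Tendsto (V f) (𝓝[>] 0) (𝓝 0) := by
      simpa [hV0] using (hVf.tendsto 0).mono_left nhdsWithin_le_nhds
    refine h.congr' ?_
    filter_upwards [Ioc_mem_nhdsGT hT₀] with t ht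
    exact (huV t ht.2).symm
  · intro Lf hLf hLfK
    have hquot (h : ℝ) : AEStronglyMeasurable (fun t => h⁻¹ • (P h (f t) - f t))
        (volume.restrict (Ioc (0 : ℝ) T₀)) :=
      (((P h).continuous.comp_aestronglyMeasurable hf_meas).sub hf_meas).const_smul h⁻¹
    have hLf_meas : AEStronglyMeasurable Lf (volume.restrict (Ioc (0 : ℝ) T₀)) :=
      aestronglyMeasurable_of_tendsto_ae _ hquot hLf
    have hquotK : ∀ h : ℝ, 0 < h →
        ∀ᵐ t ∂(volume.restrict (Ioc (0 : ℝ) T₀)), ‖h⁻¹ • (P h (f t) - f t)‖ ≤ K := by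
      intro h hh
      filter_upwards [hLf, hLfK] with t h1 h2
      have h3 := norm_semigroup_sub_self_le hP0 hPsemi hPcontr hPcont h1 hh.le
      rw [norm_smul, norm_inv, Real.norm_of_nonneg hh.le, inv_mul_le_iff₀ hh, mul_comm h]
      exact h3.trans (by gcongr)
    refine ⟨V Lf, fun t ht => ?_, (hVcont hLf_meas hLfK).continuousOn⟩
    rw [huV t ht.2]
    have hlim : Tendsto (fun h => V (fun s => h⁻¹ • (P h (f s) - f s)) t) (𝓝[>] 0)
        (𝓝 (V Lf t)) := by
      refine tendsto_integral_filter_of_dominated_convergence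
        (fun p => ‖Q ((-t, 0) + p)‖ * |K|) ?_ ?_ ((hQt t).norm.mul_const _) ?_
      · exact Eventually.of_forall fun h =>
          (hQt t).aestronglyMeasurable.smul (hIm (hquot h))
      · filter_upwards [self_mem_nhdsWithin] with h hh
        filter_upwards [hIb (hquotK h hh)] with p hp
        rw [norm_smul]
        gcongr
      · filter_upwards [Measure.quasiMeasurePreserving_fst (μ := (volume : Measure ℝ))
          (ν := (volume : Measure ℝ)) |>.ae ((ae_restrict_iff' measurableSet_Ioc).1 hLf)]
          with p hp
        refine Tendsto.const_smul ?_ _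
        by_cases hmem : p ∈ Ioc 0 T₀ ×ˢ Ioi (0 : ℝ)
        · simp only [I, indicator_of_mem hmem]
          exact ((P p.2).continuous.tendsto _).comp (hp hmem.1)
        · simp only [I, indicator_of_notMem hmem]
          exact tendsto_const_nhds
    refine hlim.congr' ?_
    filter_upwards [self_mem_nhdsWithin] with h hh
    have hf_int := hVint t hf_meas hfK
    simp only [V]
    rw [← ContinuousLinearMap.integral_comp_comm _ hf_int,
      ← integral_sub ((P h).integrable_comp hf_int) hf_int, ← integral_smul]
    refine integral_congr_ae (ae_of_all _ fun p => ?_)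
    by_cases hmem : p ∈ Ioc 0 T₀ ×ˢ Ioi (0 : ℝ)
    · have hcomm : P p.2 (P h (f p.1)) = P h (P p.2 (f p.1)) := by
        have h2 : (0 : ℝ) ≤ p.2 := le_of_lt hmem.2
        have h3 : (0 : ℝ) ≤ h := le_of_lt hh
        rw [← ContinuousLinearMap.comp_apply, ← ContinuousLinearMap.comp_apply,
          ← hPsemi _ _ h2 h3, ← hPsemi _ _ h3 h2, add_comm]
      simp only [I, indicator_of_mem hmem, map_smul, map_sub, hcomm]
      rw [← smul_sub, smul_comm]
    · simp [I, indicator_of_notMem hmem]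
end

section
/- Uniqueness of weak solutions: Let T₀ ∈ (0,∞), g ∈ L²(E;μ), and f : (0,T₀] → L²(E;μ) with ‖f(t)‖_{L²} ≤ K < ∞ for a.e. t ∈ (0,T₀]. Call u : (0,T₀] → L²(E;μ) a weak solution of ∂ᵗ_w u = 𝓛u + f with initial value g if: (i) t ↦ u(t) is continuous in L², sup_{t∈(0,T₀]} ‖u(t)‖_{L²} < ∞, and u(t) → g in L² as t ↓ 0; (ii) for every T ∈ (0,T₀], ∫₀^T w(T−t) ‖u(t)−g‖_{L²} dt < ∞, and for every φ ∈ 𝒟(𝓛): ⟨∫₀^T w(T−s)(u(s)−g) ds, φ⟩ = ∫₀^T ⟨f(s), φ⟩ ds + ∫₀^T ⟨u(s), 𝓛φ⟩ ds. Then any two weak solutions coincide on (0,T₀]. -/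
open MeasureTheory Filter Set
open scoped ENNReal Topology RealInnerProductSpace

/-- Let `P` be a strongly continuous contraction semigroup with generator `L`. If `W` satisfies
`⟪W, φ⟫ = ⟪D, L φ⟫` for all `φ` in the domain of `L`, then `⟪W, D⟫ ≤ 0`. -/
lemma inner_nonpos_of_weak_generator {H : Type*} [NormedAddCommGroup H] [InnerProductSpace ℝ H]
    [CompleteSpace H] (P : ℝ → H →L[ℝ] H) (hP0 : P 0 = ContinuousLinearMap.id ℝ H)
    (hPsemi : ∀ s t : ℝ, 0 ≤ s → 0 ≤ t → P (s + t) = (P s).comp (P t))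
    (hPcontr : ∀ t : ℝ, 0 ≤ t → ‖P t‖ ≤ 1)
    (hPcont : ∀ g : H, ContinuousOn (fun t => P t g) (Set.Ici (0:ℝ))) (W D : H)
    (hWD : ∀ φd Lφ : H,
      Tendsto (fun h : ℝ => h⁻¹ • (P h φd - φd)) (nhdsWithin 0 (Set.Ioi (0:ℝ))) (nhds Lφ) →
        ⟪W, φd⟫ = ⟪D, Lφ⟫) :
    ⟪W, D⟫ ≤ 0 := by
  set F : ℝ → H := fun s => P (max s 0) D with hF
  have hFc : Continuous F := by
    have := (hPcont D).comp_continuous (f := fun s : ℝ => max s 0) (by fun_prop)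
      (fun s => le_max_right s 0)
    exact this
  have hF0 : F 0 = D := by simp [hF, hP0]
  set Φ : ℝ → H := fun x => ∫ s in (0:ℝ)..x, F s with hΦ
  have hΦ0 : Φ 0 = 0 := by simp [hΦ]
  have hder : ∀ x, HasDerivAt Φ (F x) x := fun x =>
    intervalIntegral.integral_hasDerivAt_right (hFc.intervalIntegrable _ _)
      (hFc.stronglyMeasurableAtFilter _ _) hFc.continuousAt
  have hshift : ∀ h, 0 ≤ h → ∀ k, 0 ≤ k → P k (Φ h) = Φ (h + k) - Φ k := by
    intro h hh k hk
    have h1 : P k (Φ h) = ∫ s in (0:ℝ)..h, P k (F s) :=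
      ((P k).intervalIntegral_comp_comm (hFc.intervalIntegrable _ _)).symm
    have h2 : ∫ s in (0:ℝ)..h, P k (F s) = ∫ s in (0:ℝ)..h, F (s + k) := by
      apply intervalIntegral.integral_congr
      intro s hs
      rw [Set.uIcc_of_le hh] at hs
      simp only [hF]
      rw [max_eq_left hs.1, max_eq_left (add_nonneg hs.1 hk), add_comm s k, hPsemi k s hk hs.1]
      rfl
    rw [h1, h2, intervalIntegral.integral_comp_add_right, zero_add]
    simp only [hΦ]
    rw [intervalIntegral.integral_interval_sub_left (hFc.intervalIntegrable _ _)
      (hFc.intervalIntegrable _ _)]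
  have hineq : ∀ h, 0 < h → ⟪W, h⁻¹ • Φ h⟫ ≤ 0 := by
    intro h hh
    have hgen : ⟪W, Φ h⟫ = ⟪D, F h - F 0⟫ := by
      apply hWD
      have := (hder h).tendsto_slope_zero_right.sub (hder 0).tendsto_slope_zero_right
      refine this.congr' ?_
      filter_upwards [self_mem_nhdsWithin] with k hk
      rw [hshift h hh.le k (le_of_lt hk), ← smul_sub, hΦ0, zero_add]
      congr 1
      abel
    rw [inner_smul_right, hgen, hF0, inner_sub_right]
    have hle : ⟪D, F h⟫ ≤ ⟪D, D⟫ := by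
      refine (real_inner_le_norm _ _).trans ?_
      rw [real_inner_self_eq_norm_mul_norm]
      gcongr
      simp only [hF]
      calc ‖P (max h 0) D‖ ≤ ‖P (max h 0)‖ * ‖D‖ := (P _).le_opNorm D
        _ ≤ 1 * ‖D‖ := by gcongr; exact hPcontr _ (le_max_right _ _)
        _ = ‖D‖ := one_mul _
    exact mul_nonpos_of_nonneg_of_nonpos (inv_nonneg.2 hh.le) (by linarith)
  have hlim : Tendsto (fun h : ℝ => ⟪W, h⁻¹ • Φ h⟫) (𝓝[>] 0) (𝓝 ⟪W, D⟫) := by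
    have := (hder 0).tendsto_slope_zero_right
    simp only [zero_add, hΦ0, sub_zero, hF0] at this
    exact tendsto_const_nhds.inner this
  exact le_of_tendsto hlim (by
    filter_upwards [self_mem_nhdsWithin] with h hh using hineq h hh)

/-- Convolution of `q` against the tail of `ν` as an integral of the increments of the primitive
of `q` against `ν`. -/
lemma tail_convolution_eq_integral_increment (ν : Measure ℝ)
    (hν : ∀ a : ℝ, 0 < a → ν (Set.Ioi a) < ⊤) (t : ℝ) (q : ℝ → ℝ)
    (hq : AEStronglyMeasurable q (volume.restrict (Set.Ioc 0 t)))
    (hwq : IntegrableOn (fun s => (ν (Set.Ioi (t - s))).toReal * q s) (Set.Ioc 0 t)) :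
    IntegrableOn (fun x => ∫ s in Set.Ioc (max 0 (t - x)) t, q s) (Set.Ioi 0) ν ∧
      ∫ x in Set.Ioi 0, (∫ s in Set.Ioc (max 0 (t - x)) t, q s) ∂ν
        = ∫ s in Set.Ioc 0 t, (ν (Set.Ioi (t - s))).toReal * q s := by
  have hσ : SigmaFinite (ν.restrict (Set.Ioi 0)) := by
    refine Measure.sigmaFinite_of_countable
      (S := insert (Set.Iic 0) (Set.range fun n : ℕ => Set.Ioi (1 / ((n : ℝ) + 1))))
      ((Set.countable_range _).insert _) ?_ ?_
    · rintro s (rfl | ⟨n, rfl⟩)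
      · rw [Measure.restrict_apply measurableSet_Iic]
        simp [Set.Iic_inter_Ioi]
      · exact (Measure.restrict_apply_le _ _).trans_lt (hν _ Nat.one_div_pos_of_nat)
    · refine Set.eq_univ_of_forall fun x => ?_
      rcases le_or_gt x 0 with hx | hx
      · exact ⟨_, Set.mem_insert _ _, hx⟩
      · obtain ⟨n, hn⟩ := exists_nat_one_div_lt hx
        exact ⟨_, Set.mem_insert_of_mem _ ⟨n, rfl⟩, hn⟩
  set A : Set (ℝ × ℝ) := {p | t - p.1 < p.2} with hA
  have hAm : MeasurableSet A := measurableSet_lt (by fun_prop) (by fun_prop)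
  set G : ℝ × ℝ → ℝ := A.indicator (fun p => q p.1) with hG
  have hGs : ∀ s, (fun x => G (s, x)) = (Set.Ioi (t - s)).indicator (fun _ => q s) := by
    intro s; ext x
    simp [hG, hA, Set.indicator]
  have hne : ∀ᵐ s ∂(volume.restrict (Set.Ioc 0 t)), s < t := by
    rw [← restrict_Ioo_eq_restrict_Ioc]
    filter_upwards [ae_restrict_mem measurableSet_Ioo] with s hs using hs.2
  have hmeas : ∀ s, s < t → (ν.restrict (Set.Ioi 0)) (Set.Ioi (t - s)) = ν (Set.Ioi (t - s)) := by
    intro s hs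
    rw [Measure.restrict_apply measurableSet_Ioi, Set.inter_eq_left.2
      (Set.Ioi_subset_Ioi (sub_nonneg.2 hs.le))]
  have hGint : Integrable G ((volume.restrict (Set.Ioc 0 t)).prod (ν.restrict (Set.Ioi 0))) := by
    have hGm : AEStronglyMeasurable G
        ((volume.restrict (Set.Ioc 0 t)).prod (ν.restrict (Set.Ioi 0))) :=
      hq.comp_fst.indicator hAm
    rw [integrable_prod_iff hGm]
    constructor
    · filter_upwards [hne] with s hs
      rw [hGs, integrable_indicator_iff measurableSet_Ioi]
      refine integrableOn_const ?_
      rw [hmeas s hs]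
      exact (hν _ (sub_pos.2 hs)).ne
    · refine hwq.norm.congr ?_
      filter_upwards [hne] with s hs
      have : (fun x => ‖G (s, x)‖) = (Set.Ioi (t - s)).indicator (fun _ => ‖q s‖) := by
        ext x
        rw [congrFun (hGs s) x, Set.indicator_apply, Set.indicator_apply]
        split_ifs <;> simp
      rw [this, integral_indicator measurableSet_Ioi, setIntegral_const, Measure.real,
        hmeas s hs, norm_mul, smul_eq_mul, Real.norm_of_nonneg ENNReal.toReal_nonneg]
  have hinner : ∀ x ∈ Set.Ioi (0:ℝ),
      ∫ s in Set.Ioc 0 t, G (s, x) = ∫ s in Set.Ioc (max 0 (t - x)) t, q s := by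
    intro x hx
    have : (fun s => G (s, x)) = (Set.Ioi (t - x)).indicator q := by
      ext s
      simp only [hG, hA, Set.indicator_apply, Set.mem_ofPred_eq, Set.mem_Ioi]
      congr 1
      exact propext sub_lt_comm
    rw [this, setIntegral_indicator measurableSet_Ioi, Set.Ioc_inter_Ioi]
  constructor
  · refine hGint.integral_prod_right.congr ?_
    filter_upwards [ae_restrict_mem measurableSet_Ioi] with x hx using hinner x hx
  · rw [← setIntegral_congr_fun measurableSet_Ioi hinner,
      ← integral_integral_swap (f := fun s x => G (s, x)) hGint]
    refine integral_congr_ae ?_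
    filter_upwards [hne] with s hs
    rw [hGs, integral_indicator measurableSet_Ioi, setIntegral_const, Measure.real, hmeas s hs,
      smul_eq_mul]

/-- A maximum principle: a continuous curve `D` with `D 0 = 0` whose increments satisfy
`∫ ⟪D t - D (t - x)⁺, D t⟫ ν(dx) ≤ 0` vanishes. -/
lemma eq_zero_of_integral_increment_nonpos {H : Type*} [NormedAddCommGroup H]
    [InnerProductSpace ℝ H] (ν : Measure ℝ) (hν : ν (Set.Ioi 0) ≠ 0) (T : ℝ) (D : ℝ → H)
    (hD : ContinuousOn D (Set.Icc 0 T)) (hD0 : D 0 = 0)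
    (hint : ∀ t ∈ Set.Ioc 0 T,
      IntegrableOn (fun x => ⟪D t - D (max 0 (t - x)), D t⟫) (Set.Ioi 0) ν)
    (hle : ∀ t ∈ Set.Ioc 0 T, ∫ x in Set.Ioi 0, ⟪D t - D (max 0 (t - x)), D t⟫ ∂ν ≤ 0) :
    ∀ t ∈ Set.Icc 0 T, D t = 0 := by
  intro t₁ ht₁
  by_contra hne
  have hN : ContinuousOn (fun t => ‖D t‖) (Set.Icc 0 T) := hD.norm
  obtain ⟨m, hm, hmax⟩ := isCompact_Icc.exists_isMaxOn ⟨t₁, ht₁⟩ hN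
  have hpos : 0 < ‖D m‖ := (norm_pos_iff.2 hne).trans_le (hmax ht₁)
  have hSc : IsCompact (Set.Icc 0 T ∩ (fun t => ‖D t‖) ⁻¹' {‖D m‖}) :=
    isCompact_Icc.of_isClosed_subset
      (hN.preimage_isClosed_of_isClosed isClosed_Icc isClosed_singleton) Set.inter_subset_left
  obtain ⟨t, ⟨⟨ht, htm⟩, htmin⟩⟩ := hSc.exists_isLeast ⟨m, hm, rfl⟩
  have htm : ‖D t‖ = ‖D m‖ := htm
  have ht0 : 0 < t := by
    refine lt_of_le_of_ne ht.1 fun h => ?_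
    rw [← h, hD0, norm_zero] at htm
    exact hpos.ne htm
  have hstrict : ∀ x ∈ Set.Ioi (0:ℝ), 0 < ⟪D t - D (max 0 (t - x)), D t⟫ := by
    intro x hx
    have hx : 0 < x := hx
    have hlt : max 0 (t - x) < t := max_lt ht0 (by linarith)
    have hmem : max 0 (t - x) ∈ Set.Icc 0 T := ⟨le_max_left _ _, hlt.le.trans ht.2⟩
    have hn : ‖D (max 0 (t - x))‖ < ‖D t‖ := by
      rw [htm]
      refine lt_of_le_of_ne (hmax hmem) fun h => ?_
      exact absurd (htmin ⟨hmem, h⟩) (not_le.2 hlt)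
    rw [inner_sub_left, real_inner_self_eq_norm_mul_norm]
    have h1 := real_inner_le_norm (D (max 0 (t - x))) (D t)
    have h2 : ‖D (max 0 (t - x))‖ * ‖D t‖ < ‖D t‖ * ‖D t‖ := by
      gcongr
      rw [htm]; exact hpos
    linarith
  have hgt : 0 < ∫ x in Set.Ioi 0, ⟪D t - D (max 0 (t - x)), D t⟫ ∂ν := by
    rw [setIntegral_pos_iff_support_of_nonneg_ae _ (hint t ⟨ht0, ht.2⟩)]
    · have hsub : Set.Ioi 0 ⊆ Function.support fun x => ⟪D t - D (max 0 (t - x)), D t⟫ :=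
        fun x hx => Function.mem_support.2 (hstrict x hx).ne'
      rw [Set.inter_eq_right.2 hsub]
      exact pos_iff_ne_zero.2 hν
    · filter_upwards [ae_restrict_mem measurableSet_Ioi] with x hx using (hstrict x hx).le
  exact absurd (hle t ⟨ht0, ht.2⟩) (not_le.2 hgt)

lemma measure_Ioi_lt_top_of_lintegral_min_one (ν : Measure ℝ)
    (hν : ∫⁻ x in Set.Ioi (0:ℝ), ENNReal.ofReal (min 1 x) ∂ν ≠ ⊤) (a : ℝ) (ha : 0 < a) :
    ν (Set.Ioi a) < ⊤ := by
  have h := meas_ge_le_lintegral_div (μ := ν.restrict (Set.Ioi 0))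
    (f := fun x => ENNReal.ofReal (min 1 x)) (by fun_prop) (ε := ENNReal.ofReal (min 1 a))
    (by simp [ha]) ENNReal.ofReal_ne_top
  have hsub : Set.Ioi a ⊆
      {x | ENNReal.ofReal (min 1 a) ≤ ENNReal.ofReal (min 1 x)} ∩ Set.Ioi 0 := fun x hx =>
    ⟨ENNReal.ofReal_le_ofReal (min_le_min_left _ (le_of_lt hx)), ha.trans hx⟩
  calc ν (Set.Ioi a) ≤ _ := measure_mono hsub
    _ ≤ _ := Measure.le_restrict_apply _ _
    _ ≤ _ := h
    _ < ⊤ := ENNReal.div_lt_top hν (by simp [ha])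

/-- A continuous curve on `(0, T]` all of whose integrals from `0` vanish is zero. -/
lemma eq_zero_of_forall_integral_Ioc_eq_zero {H : Type*} [NormedAddCommGroup H]
    [NormedSpace ℝ H] [CompleteSpace H] (T : ℝ) (d : ℝ → H)
    (hd : ContinuousOn d (Set.Ioc 0 T)) (hi : IntegrableOn d (Set.Ioc 0 T))
    (h0 : ∀ t ∈ Set.Icc 0 T, ∫ s in (0:ℝ)..t, d s = 0) :
    ∀ t ∈ Set.Ioc 0 T, d t = 0 := by
  have hIoo : ∀ t ∈ Set.Ioo 0 T, d t = 0 := by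
    intro t ht
    have hc : ContinuousAt d t := hd.continuousAt (Ioc_mem_nhds ht.1 ht.2)
    have hder : HasDerivAt (fun x => ∫ s in (0:ℝ)..x, d s) (d t) t := by
      refine intervalIntegral.integral_hasDerivAt_right ?_ ?_ hc
      · rw [intervalIntegrable_iff_integrableOn_Ioc_of_le ht.1.le]
        exact hi.mono_set (Set.Ioc_subset_Ioc_right ht.2.le)
      · exact ⟨_, Ioc_mem_nhds ht.1 ht.2, hi.aestronglyMeasurable⟩
    have hz : HasDerivAt (fun x => ∫ s in (0:ℝ)..x, d s) 0 t := by
      refine (hasDerivAt_const t (0:H)).congr_of_eventuallyEq ?_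
      filter_upwards [Icc_mem_nhds ht.1 ht.2] with x hx using h0 x hx
    exact hder.unique hz
  intro t ht
  have hcl : t ∈ closure (Set.Ioo 0 T) := by
    rw [closure_Ioo (ht.1.trans_le ht.2).ne]
    exact ⟨ht.1.le, ht.2⟩
  have : (𝓝[Set.Ioo 0 T] t).NeBot := mem_closure_iff_nhdsWithin_neBot.1 hcl
  have hlim : Tendsto d (𝓝[Set.Ioo 0 T] t) (𝓝 (d t)) :=
    ((hd t ht).mono Set.Ioo_subset_Ioc_self)
  refine tendsto_nhds_unique hlim (tendsto_const_nhds.congr' ?_)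
  filter_upwards [self_mem_nhdsWithin] with s hs using (hIoo s hs).symm

/-- uniqueness of weak solutions, Theorem 1.3.  A weak solution of
`∂ᵗ_w u = 𝓛u + f` with initial value `g` is a bounded `L²`-continuous `u : (0,T₀] → L²(E;μ)`
with `u(t) → g` as `t ↓ 0`, such that for every `T ∈ (0,T₀]` the integral
`∫₀^T w(T−t)(u(t)−g) dt` converges absolutely and, for every `φ ∈ 𝒟(𝓛)`,
`⟨∫₀^T w(T−s)(u(s)−g) ds, φ⟩ = ∫₀^T ⟨f(s),φ⟩ ds + ∫₀^T ⟨u(s),𝓛φ⟩ ds`.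
Any two weak solutions coincide on `(0,T₀]`. -/
theorem time_frac_stmt7
    {α : Type*} [MeasurableSpace α] (μE : Measure α) [SigmaFinite μE]
    (ν : Measure ℝ)
    (hν_loc : ∫⁻ x in Set.Ioi (0:ℝ), ENNReal.ofReal (min 1 x) ∂ν ≠ ⊤)
    (hν_inf : ν (Set.Ioi (0:ℝ)) = ⊤)
    (φ : ℝ → ℝ)
    (hφ : ∀ l : ℝ, 0 < l → φ l = ∫ x in Set.Ioi (0:ℝ), (1 - Real.exp (-l * x)) ∂ν)
    (w : ℝ → ℝ)
    (hw : ∀ x : ℝ, w x = (ν (Set.Ioi x)).toReal)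
    (μr : ℝ → Measure ℝ)
    (hprob : ∀ r : ℝ, 0 < r → IsProbabilityMeasure (μr r))
    (hlap : ∀ r : ℝ, 0 < r → ∀ l : ℝ, 0 < l →
      ∫ s, Real.exp (-l * s) ∂(μr r) = Real.exp (-r * φ l))
    (pbar : ℝ → ℝ → ℝ)
    (hpbar_nn : ∀ r t : ℝ, 0 ≤ pbar r t)
    (hpbar_meas : Measurable (Function.uncurry pbar))
    (hpbar_bdd : ∀ r : ℝ, 0 < r → ∃ C : ℝ, ∀ t : ℝ, pbar r t ≤ C)
    (hdens : ∀ r : ℝ, 0 < r → ∀ A : Set ℝ, MeasurableSet A →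
      μr r A = ∫⁻ t in A ∩ Set.Ici 0, ENNReal.ofReal (pbar r t))
    -- strongly continuous contraction semigroup of self-adjoint operators on L²(E;μ)
    (P : ℝ → Lp ℝ 2 μE →L[ℝ] Lp ℝ 2 μE)
    (hP0 : P 0 = ContinuousLinearMap.id ℝ (Lp ℝ 2 μE))
    (hPsemi : ∀ s t : ℝ, 0 ≤ s → 0 ≤ t → P (s + t) = (P s).comp (P t))
    (hPcontr : ∀ t : ℝ, 0 ≤ t → ‖P t‖ ≤ 1)
    (hPcont : ∀ g : Lp ℝ 2 μE, ContinuousOn (fun t => P t g) (Set.Ici (0:ℝ)))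
    (hPsym : ∀ t : ℝ, 0 ≤ t → ∀ g h : Lp ℝ 2 μE, ⟪P t g, h⟫ = ⟪g, P t h⟫)
    -- data
    (T₀ : ℝ) (hT₀ : 0 < T₀) (g : Lp ℝ 2 μE)
    (f : ℝ → Lp ℝ 2 μE)
    (hf_meas : AEStronglyMeasurable f (volume.restrict (Set.Ioc (0:ℝ) T₀)))
    (K : ℝ)
    (hfK : ∀ᵐ s ∂(volume.restrict (Set.Ioc (0:ℝ) T₀)), ‖f s‖ ≤ K)
    -- u is a weak solution
    (u : ℝ → Lp ℝ 2 μE)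
    (hu_cont : ContinuousOn u (Set.Ioc (0:ℝ) T₀))
    (hu_bdd : ∃ C : ℝ, ∀ t ∈ Set.Ioc (0:ℝ) T₀, ‖u t‖ ≤ C)
    (hu0 : Tendsto u (nhdsWithin 0 (Set.Ioi (0:ℝ))) (nhds g))
    (hu_eq : ∀ T ∈ Set.Ioc (0:ℝ) T₀,
      IntegrableOn (fun t => w (T - t) • (u t - g)) (Set.Ioc 0 T) ∧
      ∀ φd Lφ : Lp ℝ 2 μE,
        Tendsto (fun h : ℝ => h⁻¹ • (P h φd - φd)) (nhdsWithin 0 (Set.Ioi (0:ℝ)))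
          (nhds Lφ) →
        ⟪∫ s in Set.Ioc (0:ℝ) T, w (T - s) • (u s - g), φd⟫
          = (∫ s in Set.Ioc (0:ℝ) T, ⟪f s, φd⟫) + ∫ s in Set.Ioc (0:ℝ) T, ⟪u s, Lφ⟫)
    -- v is a weak solution
    (v : ℝ → Lp ℝ 2 μE)
    (hv_cont : ContinuousOn v (Set.Ioc (0:ℝ) T₀))
    (hv_bdd : ∃ C : ℝ, ∀ t ∈ Set.Ioc (0:ℝ) T₀, ‖v t‖ ≤ C)
    (hv0 : Tendsto v (nhdsWithin 0 (Set.Ioi (0:ℝ))) (nhds g))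
    (hv_eq : ∀ T ∈ Set.Ioc (0:ℝ) T₀,
      IntegrableOn (fun t => w (T - t) • (v t - g)) (Set.Ioc 0 T) ∧
      ∀ φd Lφ : Lp ℝ 2 μE,
        Tendsto (fun h : ℝ => h⁻¹ • (P h φd - φd)) (nhdsWithin 0 (Set.Ioi (0:ℝ)))
          (nhds Lφ) →
        ⟪∫ s in Set.Ioc (0:ℝ) T, w (T - s) • (v s - g), φd⟫
          = (∫ s in Set.Ioc (0:ℝ) T, ⟪f s, φd⟫) + ∫ s in Set.Ioc (0:ℝ) T, ⟪v s, Lφ⟫) :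
    ∀ t ∈ Set.Ioc (0:ℝ) T₀, u t = v t := by
  have hνfin := measure_Ioi_lt_top_of_lintegral_min_one ν hν_loc
  have hint : ∀ z : ℝ → Lp ℝ 2 μE, ContinuousOn z (Set.Ioc 0 T₀) →
      (∃ C : ℝ, ∀ t ∈ Set.Ioc (0:ℝ) T₀, ‖z t‖ ≤ C) → IntegrableOn z (Set.Ioc 0 T₀) := by
    rintro z hz ⟨C, hC⟩
    refine Integrable.of_bound (hz.aestronglyMeasurable measurableSet_Ioc) C ?_
    filter_upwards [ae_restrict_mem measurableSet_Ioc] with s hs using hC s hs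
  have hui := hint u hu_cont hu_bdd
  have hvi := hint v hv_cont hv_bdd
  set d : ℝ → Lp ℝ 2 μE := fun s => u s - v s with hd
  have hdi : IntegrableOn d (Set.Ioc 0 T₀) := hui.sub hvi
  set D : ℝ → Lp ℝ 2 μE := fun t => ∫ s in (0:ℝ)..t, d s with hD
  have hdI : ∀ a ∈ Set.Icc 0 T₀, ∀ b ∈ Set.Icc 0 T₀, IntervalIntegrable d volume a b := by
    intro a ha b hb
    rw [intervalIntegrable_iff]
    exact hdi.mono_set (Set.Ioc_subset_Ioc (le_min ha.1 hb.1) (max_le ha.2 hb.2))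
  have hwd : ∀ t ∈ Set.Ioc 0 T₀, IntegrableOn (fun s => w (t - s) • d s) (Set.Ioc 0 t) := by
    intro t ht
    refine ((hu_eq t ht).1.sub (hv_eq t ht).1).congr (ae_of_all _ fun s => ?_)
    simp only [hd, Pi.sub_apply, ← smul_sub, sub_sub_sub_cancel_right]
  have hweak : ∀ t ∈ Set.Ioc 0 T₀, ∀ φd Lφ : Lp ℝ 2 μE,
      Tendsto (fun h : ℝ => h⁻¹ • (P h φd - φd)) (nhdsWithin 0 (Set.Ioi (0:ℝ))) (nhds Lφ) →
        ⟪∫ s in Set.Ioc (0:ℝ) t, w (t - s) • d s, φd⟫ = ⟪D t, Lφ⟫ := by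
    intro t ht φd Lφ hL
    have hsub : Set.Ioc 0 t ⊆ Set.Ioc 0 T₀ := Set.Ioc_subset_Ioc_right ht.2
    have e1 : ∫ s in Set.Ioc (0:ℝ) t, w (t - s) • d s
        = (∫ s in Set.Ioc (0:ℝ) t, w (t - s) • (u s - g))
          - ∫ s in Set.Ioc (0:ℝ) t, w (t - s) • (v s - g) := by
      rw [← integral_sub (hu_eq t ht).1 (hv_eq t ht).1]
      simp only [hd, ← smul_sub, sub_sub_sub_cancel_right]
    have hcomm : ∀ z : ℝ → Lp ℝ 2 μE, IntegrableOn z (Set.Ioc 0 t) →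
        ∫ s in Set.Ioc (0:ℝ) t, ⟪z s, Lφ⟫ = ⟪∫ s in Set.Ioc (0:ℝ) t, z s, Lφ⟫ := by
      intro z hz
      simp only [real_inner_comm Lφ]
      exact integral_inner hz Lφ
    have e2 : D t = (∫ s in Set.Ioc (0:ℝ) t, u s) - ∫ s in Set.Ioc (0:ℝ) t, v s := by
      simp only [hD]
      rw [intervalIntegral.integral_of_le ht.1.le,
        ← integral_sub (hui.mono_set hsub) (hvi.mono_set hsub)]
    rw [e1, e2, inner_sub_left, inner_sub_left, (hu_eq t ht).2 φd Lφ hL,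
      (hv_eq t ht).2 φd Lφ hL, hcomm u (hui.mono_set hsub), hcomm v (hvi.mono_set hsub)]
    ring
  have hW : ∀ t ∈ Set.Ioc 0 T₀,
      ⟪∫ s in Set.Ioc (0:ℝ) t, w (t - s) • d s, D t⟫ ≤ 0 := fun t ht =>
    inner_nonpos_of_weak_generator P hP0 hPsemi hPcontr hPcont _ _ (hweak t ht)
  have hconv : ∀ t ∈ Set.Ioc 0 T₀,
      IntegrableOn (fun x => ⟪D t - D (max 0 (t - x)), D t⟫) (Set.Ioi 0) ν ∧
      ∫ x in Set.Ioi 0, ⟪D t - D (max 0 (t - x)), D t⟫ ∂ν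
        = ⟪∫ s in Set.Ioc (0:ℝ) t, w (t - s) • d s, D t⟫ := by
    intro t ht
    have hdt : IntegrableOn d (Set.Ioc 0 t) := hdi.mono_set (Set.Ioc_subset_Ioc_right ht.2)
    have hwdt := hwd t ht
    have hwq : IntegrableOn (fun s => (ν (Set.Ioi (t - s))).toReal * ⟪D t, d s⟫)
        (Set.Ioc 0 t) := by
      refine (hwdt.const_inner (D t)).congr (ae_of_all _ fun s => ?_)
      simp only [inner_smul_right, hw]
    obtain ⟨h1, h2⟩ := tail_convolution_eq_integral_increment ν hνfin t (fun s => ⟪D t, d s⟫)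
      (hdt.const_inner (D t)).aestronglyMeasurable hwq
    have hinc : ∀ x ∈ Set.Ioi (0:ℝ), ∫ s in Set.Ioc (max 0 (t - x)) t, ⟪D t, d s⟫
        = ⟪D t - D (max 0 (t - x)), D t⟫ := by
      intro x hx
      have hle : max 0 (t - x) ≤ t := max_le ht.1.le (by linarith [Set.mem_Ioi.1 hx])
      have hmem : max 0 (t - x) ∈ Set.Icc 0 T₀ := ⟨le_max_left _ _, hle.trans ht.2⟩
      have hsub : Set.Ioc (max 0 (t - x)) t ⊆ Set.Ioc 0 t :=
        Set.Ioc_subset_Ioc_left (le_max_left _ _)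
      rw [integral_inner (hdt.mono_set hsub), real_inner_comm]
      congr 1
      simp only [hD]
      rw [intervalIntegral.integral_interval_sub_left
        (hdI 0 ⟨le_rfl, hT₀.le⟩ t ⟨ht.1.le, ht.2⟩) (hdI 0 ⟨le_rfl, hT₀.le⟩ _ hmem),
        intervalIntegral.integral_of_le hle]
    refine ⟨h1.congr_fun hinc measurableSet_Ioi, ?_⟩
    rw [← setIntegral_congr_fun measurableSet_Ioi hinc, h2, real_inner_comm,
      ← integral_inner hwdt]
    simp only [inner_smul_right, hw]
  have hDc : ContinuousOn D (Set.Icc 0 T₀) := by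
    have := intervalIntegral.continuousOn_primitive_interval (μ := volume) (f := d) (a := 0)
      (b := T₀) (by rwa [Set.uIcc_of_le hT₀.le, integrableOn_Icc_iff_integrableOn_Ioc])
    rwa [Set.uIcc_of_le hT₀.le] at this
  have hDzero : ∀ t ∈ Set.Icc 0 T₀, D t = 0 :=
    eq_zero_of_integral_increment_nonpos ν (by simp [hν_inf]) T₀ D hDc (by simp [hD])
      (fun t ht => (hconv t ht).1) (fun t ht => (hconv t ht).2.trans_le (hW t ht))
  intro t ht
  exact sub_eq_zero.1 (eq_zero_of_forall_integral_Ioc_eq_zero T₀ d (hu_cont.sub hv_cont) hdi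
    hDzero t ht)
end
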